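/- arXiv:2604.22147 — 2 statements merged into one kernel-verified Lean document; each statement's English description precedes it below -/
import Mathlib

section
/- Let α be a real number and suppose there exist an integer a and a positive integer q with gcd(a,q) = 1 and |α − a/q| < q^{−2}. Let k ≥ 2 be an integer. Then for every ε > 0 there is a constant C(ε,k) such that for all N ≥ 2, |Σ_{1 ≤ p ≤ N} (log p) e(α p^k)| ≤ C(ε,k) N^{1+ε} (1/q + 1/N^{1/2} + q/N^k)^{4^{1−k}}, where the sum is over primes p ≤ N. -/
open MeasureTheory Finset
open scoped Classical

/-- `e(x) = exp(2πix)`. -/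
noncomputable def e (x : ℝ) : ℂ := Complex.exp (2 * Real.pi * Complex.I * x)

/-- Fejér-type kernel `K_τ(α)`. -/
noncomputable def Kf (τ α : ℝ) : ℝ :=
  if α = 0 then τ ^ 2 else (Real.sin (Real.pi * τ * α) / (Real.pi * α)) ^ 2

/-- `ψ(m,z) = 1` if every prime factor of `m` is `≥ z`, else `0`. -/
noncomputable def psi (m : ℕ) (z : ℝ) : ℝ :=
  if ∀ p : ℕ, p.Prime → p ∣ m → z ≤ (p : ℝ) then 1 else 0

/-- `z(p)` in the sieve weights. -/
noncomputable def zP (X : ℝ) (p : ℕ) : ℝ :=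
  if (p : ℝ) < X ^ ((1:ℝ)/7) then X ^ ((5:ℝ)/28) * (p : ℝ) ^ (-(1:ℝ)/2)
  else if (p : ℝ) ≤ X ^ ((3:ℝ)/14) then (p : ℝ)
  else X ^ ((5:ℝ)/14) / (p : ℝ)

/-- The sieve function `ρ(m)` of Harman–Kumchev. -/
noncomputable def rho (X : ℝ) (m : ℕ) : ℝ :=
  psi m (X ^ ((5:ℝ)/42)) -
    ∑ p ∈ m.primeFactors.filter
        (fun p : ℕ => X ^ ((5:ℝ)/42) ≤ (p:ℝ) ∧ (p:ℝ) ≤ X ^ ((1:ℝ)/4)),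
      psi (m / p) (zP X p)

/-- `S_k(α) = Σ_{p ∈ [(ηX)^{1/k}, X^{1/k}]} (log p) e(p^k α)`, sum over primes. -/
noncomputable def SS (η X : ℝ) (k : ℕ) (α : ℝ) : ℂ :=
  ∑ p ∈ (Finset.Icc 1 ⌊X ^ ((1:ℝ)/(k:ℝ))⌋₊).filter
      (fun p : ℕ => p.Prime ∧ (η * X) ^ ((1:ℝ)/(k:ℝ)) ≤ (p : ℝ)),
    (Real.log p : ℂ) * e ((p : ℝ) ^ k * α)

/-- `S₂(α, ρ) = Σ_{m ∈ [(ηX)^{1/2}, X^{1/2}]} ρ(m) e(m²α)`. -/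
noncomputable def S2 (η X α : ℝ) : ℂ :=
  ∑ m ∈ (Finset.Icc 1 ⌊X ^ ((1:ℝ)/2)⌋₊).filter
      (fun m : ℕ => (η * X) ^ ((1:ℝ)/2) ≤ (m : ℝ)),
    (rho X m : ℂ) * e ((m : ℝ) ^ 2 * α)

/-- `S_r(α)` for real `r ≥ 1`. -/
noncomputable def Sr (η X r α : ℝ) : ℂ :=
  ∑ p ∈ (Finset.Icc 1 ⌊X ^ (1/r)⌋₊).filter
      (fun p : ℕ => p.Prime ∧ (η * X) ^ (1/r) ≤ (p : ℝ)),
    (Real.log p : ℂ) * e ((p : ℝ) ^ r * α)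

/-- `U_r(α)` for real `r ≥ 1`. -/
noncomputable def Ur (η X r α : ℝ) : ℂ :=
  ∑ n ∈ (Finset.Icc 1 ⌊X ^ (1/r)⌋₊).filter
      (fun n : ℕ => (η * X) ^ (1/r) ≤ (n : ℝ)),
    e ((n : ℝ) ^ r * α)

/-- Chebyshev's function `θ(x) = Σ_{p ≤ x} log p`. -/
noncomputable def theta (x : ℝ) : ℝ :=
  ∑ p ∈ (Finset.Icc 1 ⌊x⌋₊).filter Nat.Prime, Real.log p

/-- `J_r(X,h)`. -/
noncomputable def J (ε r X h : ℝ) : ℝ :=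
  ∫ x in Set.Icc (ε * X) X,
    (theta ((x + h) ^ (1/r)) - theta (x ^ (1/r)) - ((x + h) ^ (1/r) - x ^ (1/r))) ^ 2

/-- `T_n(α) = ∫_{(ηX)^{1/n}}^{X^{1/n}} e(t^n α) dt`. -/
noncomputable def T (η X : ℝ) (n : ℕ) (α : ℝ) : ℂ :=
  ∫ t in Set.Icc ((η * X) ^ ((1:ℝ)/(n:ℝ))) (X ^ ((1:ℝ)/(n:ℝ))), e (t ^ n * α)

/-- `m₁(k)`. -/
noncomputable def m1 (k : ℕ) : ℝ :=
  if k = 5 then 2 * (⌈343 * (k:ℝ) / 50 - 20⌉ : ℝ)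
  else 2 * (⌈(49 * (k:ℝ) / 50 - (⌊49 * (k:ℝ) / 50⌋ : ℝ) / 2)
      * ((⌊49 * (k:ℝ) / 50⌋ : ℝ) + 1)⌉ : ℝ)

/-- `σ(k) = 44/45 − 24/(25 m₁(k))`. -/
noncomputable def sigma' (k : ℕ) : ℝ := 44/45 - 24 / (25 * m1 k)

/-- `m(k)` depending on `δ`. -/
noncomputable def mδ (k : ℕ) (δ : ℝ) : ℝ :=
  if ⌊(k:ℝ) * δ⌋ ≤ 3 then
    2 * (⌈((k:ℝ) * δ + 1 - (⌊(k:ℝ) * δ⌋ : ℝ)) * (2:ℝ) ^ (⌊(k:ℝ) * δ - 1⌋)⌉ : ℝ)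
  else if ⌊(k:ℝ) * δ⌋ = 4 then 2 * (⌈7 * (k:ℝ) * δ - 20⌉ : ℝ)
  else 2 * (⌈((k:ℝ) * δ - (⌊(k:ℝ) * δ⌋ : ℝ)/2) * ((⌊(k:ℝ) * δ⌋ : ℝ) + 1)⌉ : ℝ)

/-- `m₂(k)`. -/
noncomputable def m2 (k : ℕ) : ℝ :=
  if k = 5 then
    2 * (⌈(2 * (k:ℝ)/3 + 1 - (⌊2 * (k:ℝ)/3⌋ : ℝ)) * (2:ℝ) ^ (⌊2 * (k:ℝ)/3⌋ - 1)⌉ : ℝ)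
  else if k ≤ 7 then 2 * (⌈14 * (k:ℝ)/3 - 20⌉ : ℝ)
  else 2 * (⌈(2 * (k:ℝ)/3 - (⌊2 * (k:ℝ)/3⌋ : ℝ)/2) * ((⌊2 * (k:ℝ)/3⌋ : ℝ) + 1)⌉ : ℝ)

namespace HarmanAux

lemma e_add (x y : ℝ) : e (x + y) = e x * e y := by
  unfold e; rw [← Complex.exp_add]; congr 1; push_cast; ring

lemma norm_e (x : ℝ) : ‖e x‖ = 1 := by
  unfold e
  have : (2 * Real.pi * Complex.I * x : ℂ) = ((2 * Real.pi * x : ℝ) : ℂ) * Complex.I := by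
    push_cast; ring
  rw [this, Complex.norm_exp_ofReal_mul_I]

lemma e_zero : e 0 = 1 := by simp [e]

lemma conj_e (x : ℝ) : (starRingEnd ℂ) (e x) = e (-x) := by
  unfold e; rw [← Complex.exp_conj]; congr 1; simp; left; exact map_ofNat _ 2

lemma e_int (n : ℤ) : e n = 1 := by
  unfold e
  rw [Complex.exp_eq_one_iff]; exact ⟨n, by push_cast; ring⟩

/-- distance to the nearest integer -/
noncomputable def nn (x : ℝ) : ℝ := |x - round x|

lemma nn_nonneg (x : ℝ) : 0 ≤ nn x := abs_nonneg _

lemma nn_le (x : ℝ) (z : ℤ) : nn x ≤ |x - z| := round_le x z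

lemma nn_neg (x : ℝ) : nn (-x) = nn x := by
  apply le_antisymm
  · refine (nn_le (-x) (-round x)).trans (le_of_eq ?_)
    unfold nn; rw [← abs_neg]; congr 1; push_cast; ring
  · refine (nn_le x (-round (-x))).trans (le_of_eq ?_)
    unfold nn; rw [← abs_neg]; congr 1; push_cast; ring

lemma norm_e_sub_one (x : ℝ) : 4 * nn x ≤ ‖e x - 1‖ := by
  have h1 : e x = e (x - round x) := by
    conv_lhs => rw [show x = (x - round x) + (round x : ℤ) by ring, e_add, e_int, mul_one]
  rw [h1]
  set y := x - round x with hy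
  have hy2 : |y| ≤ 1/2 := abs_sub_round x
  have h2 : ‖e y - 1‖ = 2 * |Real.sin (Real.pi * y)| := by
    unfold e
    have : (2 * Real.pi * Complex.I * y : ℂ) = Complex.I * ((2 * Real.pi * y : ℝ) : ℂ) := by
      push_cast; ring
    rw [this, Complex.norm_exp_I_mul_ofReal_sub_one]
    rw [norm_mul]; simp; ring_nf
  have h3 : |Real.sin (Real.pi * y)| = Real.sin (Real.pi * |y|) := by
    rcases le_total 0 y with h | h
    · rw [abs_of_nonneg h, abs_of_nonneg]
      apply Real.sin_nonneg_of_nonneg_of_le_pi (by positivity)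
      have := abs_le.1 hy2
      nlinarith [Real.pi_pos]
    · rw [abs_of_nonpos h, mul_neg, Real.sin_neg, abs_of_nonpos]
      apply Real.sin_nonpos_of_nonpos_of_neg_pi_le
      · nlinarith [Real.pi_pos]
      · have := abs_le.1 hy2
        nlinarith [Real.pi_pos]
  have h4 := Real.mul_le_sin (x := Real.pi * |y|) (by positivity)
    (by nlinarith [Real.pi_pos])
  rw [h2, h3]
  have : 2 / Real.pi * (Real.pi * |y|) = 2 * |y| := by
    field_simp
  rw [this] at h4
  show 4 * |y| ≤ _
  linarith

lemma geom_e (β : ℝ) (A B : ℤ) (hAB : A ≤ B + 1) :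
    (∑ n ∈ Icc A B, e (β * n)) * (e β - 1) = e (β * (B + 1)) - e (β * A) := by
  obtain ⟨m, hm⟩ := Int.eq_ofNat_of_zero_le (sub_nonneg.2 hAB)
  obtain rfl : B = A + m - 1 := by linarith
  clear hAB hm
  induction m with
  | zero => simp
  | succ m ih =>
    have : Icc A (A + ((m + 1 : ℕ) : ℤ) - 1) = insert (A + m) (Icc A (A + (m : ℤ) - 1)) := by
      ext x; simp; omega
    rw [this, sum_insert (by simp), add_mul, ih]
    have h1 : e (β * ((A + ((m + 1 : ℕ) : ℤ) - 1 : ℤ) + 1)) = e (β * ((A + m : ℤ))) * e β := by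
      rw [← e_add]; congr 1; push_cast; ring
    have h2 : e (β * ((A + (m : ℤ) - 1 : ℤ) + 1)) = e (β * ((A + m : ℤ))) := by
      congr 1; push_cast; ring
    rw [h1, h2]; ring

/-- the kernel bounding geometric sums -/
noncomputable def gk (P β : ℝ) : ℝ := 2 * P / (1 + P * nn β)

lemma gk_nonneg {P : ℝ} (hP : 0 < P) (β : ℝ) : 0 ≤ gk P β := by
  unfold gk; have := nn_nonneg β; positivity

lemma gk_neg (P β : ℝ) : gk P (-β) = gk P β := by simp [gk, nn_neg]

lemma gk_le {P : ℝ} (hP : 0 < P) (β : ℝ) : gk P β ≤ 2 * P := by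
  unfold gk; have := nn_nonneg β
  exact div_le_self (by positivity) (by nlinarith)

lemma gk_le_of {P x : ℝ} (hP : 0 < P) (hx : 0 < x) (β : ℝ) (h : x ≤ nn β) : gk P β ≤ 2 / x := by
  unfold gk
  rw [div_le_div_iff₀ (by nlinarith) hx]
  nlinarith

lemma gk_zero (P : ℝ) : gk P 0 = 2 * P := by simp [gk, nn]

lemma geom_le (β P : ℝ) (hP : 0 < P) (A B : ℤ) (h : ((B - A + 1 : ℤ) : ℝ) ≤ P) :
    ‖∑ n ∈ Icc A B, e (β * n)‖ ≤ gk P β := by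
  rcases lt_or_ge (B + 1) A with h1 | h1
  · rw [Icc_eq_empty (by omega)]; simp [gk_nonneg hP]
  have e1 : ‖∑ n ∈ Icc A B, e (β * n)‖ ≤ P := by
    refine (norm_sum_le _ _).trans ?_
    simp only [norm_e, sum_const, nsmul_eq_mul, mul_one, Int.card_Icc]
    refine le_trans (le_of_eq ?_) h
    have : ((B + 1 - A).toNat : ℤ) = B - A + 1 := by omega
    exact_mod_cast this
  have e2 : ‖∑ n ∈ Icc A B, e (β * n)‖ * (4 * nn β) ≤ 2 := by
    calc _ ≤ ‖∑ n ∈ Icc A B, e (β * n)‖ * ‖e β - 1‖ := by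
          gcongr; exact norm_e_sub_one β
      _ = ‖e (β * (B + 1)) - e (β * A)‖ := by rw [← norm_mul, geom_e β A B h1]
      _ ≤ _ := by
          refine (norm_sub_le _ _).trans ?_
          rw [norm_e, norm_e]; norm_num
  unfold gk
  have := nn_nonneg β
  rw [le_div_iff₀ (by positivity)]
  nlinarith

end HarmanAux

namespace HarmanAux

lemma nn_add_le (x y : ℝ) : nn (x + y) ≤ nn x + |y| := by
  calc nn (x + y) ≤ |x + y - round x| := nn_le _ _
    _ ≤ |x - round x| + |y| := by
        rw [show x + y - round x = (x - round x) + y by ring]; exact abs_add_le _ _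

lemma nn_rat (a : ℤ) (q : ℕ) (hq : 0 < q) (d : ℤ) (hd : ¬ (q : ℤ) ∣ a * d) :
    1 / (q:ℝ) ≤ nn ((a:ℝ) / q * d) := by
  unfold nn
  set r := round ((a:ℝ) / q * d)
  have hq' : (0:ℝ) < q := by exact_mod_cast hq
  have : (a:ℝ) / q * d - r = ((a * d - q * r : ℤ) : ℝ) / q := by
    push_cast; field_simp
  rw [this, abs_div, abs_of_pos hq']
  gcongr
  have h : a * d - q * r ≠ 0 := fun h => hd ⟨r, by linarith⟩
  exact_mod_cast Int.one_le_abs h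

lemma spacing (α : ℝ) (a : ℤ) (q : ℕ) (hq : 0 < q) (hc : Int.gcd a (q : ℤ) = 1)
    (h : |α - (a : ℝ) / (q : ℝ)| < 1/(q:ℝ)^2) (d : ℤ) (hd : d ≠ 0) (hd2 : 2 * |d| < q) :
    1 / (2 * q : ℝ) ≤ nn (α * d) := by
  have hq' : (0:ℝ) < q := by exact_mod_cast hq
  have hnd : ¬ (q : ℤ) ∣ a * d := by
    intro hdv
    have h1 : (q:ℤ) ∣ d := IsCoprime.dvd_of_dvd_mul_left
      (Int.isCoprime_iff_gcd_eq_one.2 (by rw [Int.gcd_comm]; exact hc)) hdv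
    have := Int.le_of_dvd (abs_pos.2 hd) ((dvd_abs _ _).2 h1)
    omega
  have h1 := nn_rat a q hq d hnd
  have h2 : nn ((a:ℝ) / q * d) ≤ nn (α * d) + |((a:ℝ) / q - α) * d| := by
    have := nn_add_le (α * d) (((a:ℝ) / q - α) * d)
    rwa [show α * d + ((a:ℝ) / q - α) * d = (a:ℝ) / q * d by ring] at this
  have h3 : |((a:ℝ) / q - α) * d| ≤ 1 / (2 * q) := by
    rw [abs_mul, abs_sub_comm]
    have : |(d:ℝ)| ≤ q / 2 := by
      have : (2 * |d| : ℤ) ≤ (q:ℤ) := hd2.le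
      have : (2 * |(d:ℝ)|) ≤ (q:ℝ) := by exact_mod_cast this
      linarith
    calc _ ≤ 1 / (q:ℝ)^2 * (q/2) := by gcongr
      _ = _ := by field_simp
  have : 1 / (q:ℝ) = 1 / (2*q) + 1/(2*q) := by field_simp; norm_num
  linarith

lemma nn_lower (x : ℝ) : min (Int.fract x) (1 - Int.fract x) ≤ nn x := by
  unfold nn; rw [abs_sub_round_eq_min]

/-- a well-spaced block -/
lemma block_le (q : ℕ) (hq : 0 < q) (P : ℝ) (hP : 0 < P) (s : Finset ℕ) (x : ℕ → ℝ)
    (hs : ∀ i ∈ s, ∀ j ∈ s, i ≠ j → 1 / (2 * q : ℝ) ≤ nn (x i - x j)) :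
    ∑ i ∈ s, gk P (x i) ≤ 4 * P + 8 * q * (1 + Real.log (2 * q)) := by
  have hq' : (0:ℝ) < q := by exact_mod_cast hq
  set n := 2 * q with hn
  have hnq : (n:ℝ) = 2 * q := by push_cast [hn]; ring
  have hn0 : (0:ℝ) < n := by rw [hnq]; positivity
  set b : ℕ → ℕ := fun i => ⌊(n:ℝ) * Int.fract (x i)⌋₊ with hb
  have hbl : ∀ i, (b i : ℝ) ≤ n * Int.fract (x i) := fun i =>
    Nat.floor_le (by have := Int.fract_nonneg (x i); positivity)
  have hbu : ∀ i, (n:ℝ) * Int.fract (x i) < b i + 1 := fun i => Nat.lt_floor_add_one _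
  have hbn : ∀ i, b i < n := by
    intro i
    have h1 := hbl i
    have h2 := Int.fract_lt_one (x i)
    have : (b i : ℝ) < n := by nlinarith
    exact_mod_cast this
  set w : ℕ → ℝ := fun c => if c = 0 then 2 * P else 2 * n / c with hw
  have hw0 : ∀ c, 0 ≤ w c := by
    intro c; simp only [hw]; split_ifs <;> positivity
  have key : ∀ i, gk P (x i) ≤ w (b i) + w (n - 1 - b i) := by
    intro i
    by_cases h0 : b i = 0
    · have : w (b i) = 2 * P := by simp [hw, h0]
      have := gk_le hP (x i)
      have := hw0 (n - 1 - b i)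
      linarith
    by_cases h1 : n - 1 - b i = 0
    · have : w (n - 1 - b i) = 2 * P := by simp [hw, h1]
      have := gk_le hP (x i)
      have := hw0 (b i)
      linarith
    have e1 : w (b i) = 2 * n / (b i) := by simp only [hw, if_neg h0]
    have e2 : w (n - 1 - b i) = 2 * n / ((n - 1 - b i : ℕ) : ℝ) := by simp only [hw, if_neg h1]
    have hc : ((n - 1 - b i : ℕ) : ℝ) = n - 1 - b i := by
      have := hbn i
      rw [Nat.cast_sub (by omega), Nat.cast_sub (by omega)]; simp
    have hl := nn_lower (x i)
    have p0 : (0:ℝ) < b i := by exact_mod_cast Nat.pos_of_ne_zero h0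
    have p1 : (0:ℝ) < ((n - 1 - b i : ℕ) : ℝ) := by exact_mod_cast Nat.pos_of_ne_zero h1
    rcases min_choice (Int.fract (x i)) (1 - Int.fract (x i)) with hm | hm
    · rw [hm] at hl
      have : (b i : ℝ) / n ≤ nn (x i) := by
        refine le_trans ?_ hl
        rw [div_le_iff₀ hn0]; linarith [hbl i]
      have h3 := gk_le_of hP (by positivity) _ this
      have := hw0 (n - 1 - b i)
      rw [e1]
      have : 2 / ((b i : ℝ) / n) = 2 * n / b i := by field_simp
      linarith
    · rw [hm] at hl
      have : ((n - 1 - b i : ℕ) : ℝ) / n ≤ nn (x i) := by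
        refine le_trans ?_ hl
        rw [div_le_iff₀ hn0, hc]; nlinarith [hbu i]
      have h3 := gk_le_of hP (by positivity) _ this
      have := hw0 (b i)
      rw [e2]
      have : 2 / (((n - 1 - b i : ℕ) : ℝ) / n) = 2 * n / ((n - 1 - b i : ℕ) : ℝ) := by field_simp
      linarith
  have hinj : Set.InjOn b s := by
    intro i hi j hj hij
    by_contra hne
    have h1 := hs i hi j hj hne
    have h2 : nn (x i - x j) < 1 / (2 * q) := by
      refine lt_of_le_of_lt (nn_le _ (⌊x i⌋ - ⌊x j⌋)) ?_
      have : x i - x j - ((⌊x i⌋ - ⌊x j⌋ : ℤ) : ℝ) = Int.fract (x i) - Int.fract (x j) := by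
        simp only [Int.fract]; push_cast; ring
      rw [this, ← hnq, lt_div_iff₀ hn0, ← abs_of_pos hn0, ← abs_mul, abs_lt]
      have a1 := hbl i; have a2 := hbu i; have a3 := hbl j; have a4 := hbu j
      rw [hij] at a1 a2
      constructor <;> nlinarith
    linarith
  have hsum : ∑ c ∈ range n, w c ≤ 2 * P + 2 * n * (1 + Real.log n) := by
    obtain ⟨m, hm⟩ : ∃ m, n = m + 1 := ⟨n - 1, by omega⟩
    have hlog : Real.log m ≤ Real.log n := by
      rcases Nat.eq_zero_or_pos m with h | h
      · rw [h]; simp; exact Real.log_nonneg (by rw [hm]; simp)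
      · apply Real.log_le_log (by exact_mod_cast h); rw [hm]; push_cast; linarith
    have hh := harmonic_le_one_add_log m
    rw [hm, sum_range_succ', ← hm]
    have e1 : w 0 = 2 * P := by simp [hw]
    have e2 : ∑ c ∈ range m, w (c + 1) = 2 * n * (harmonic m : ℝ) := by
      unfold harmonic; push_cast; rw [mul_sum]
      refine sum_congr rfl fun c _ => ?_
      simp [hw, div_eq_mul_inv]
    rw [e1, e2]
    nlinarith
  calc ∑ i ∈ s, gk P (x i) ≤ ∑ i ∈ s, (w (b i) + w (n - 1 - b i)) := sum_le_sum fun i _ => key i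
    _ = ∑ c ∈ s.image b, (w c + w (n - 1 - c)) := by rw [sum_image hinj]
    _ ≤ ∑ c ∈ range n, (w c + w (n - 1 - c)) := by
        apply sum_le_sum_of_subset_of_nonneg
        · intro c hc
          obtain ⟨i, _, rfl⟩ := mem_image.1 hc
          exact mem_range.2 (hbn i)
        · intro c _ _; exact add_nonneg (hw0 _) (hw0 _)
    _ = 2 * ∑ c ∈ range n, w c := by
        rw [sum_add_distrib, sum_range_reflect w n]; ring
    _ ≤ 2 * (2 * P + 2 * n * (1 + Real.log n)) := by gcongr
    _ = _ := by rw [hnq]; ring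

lemma sum_gk_le (α : ℝ) (a : ℤ) (q : ℕ) (hq : 0 < q) (hc : Int.gcd a (q : ℤ) = 1)
    (h : |α - (a : ℝ) / (q : ℝ)| < 1/(q:ℝ)^2) (P : ℝ) (hP : 0 < P) (Y : ℕ) :
    ∑ l ∈ Icc 1 Y, gk P (α * l) ≤
      (2 * Y / q + 1) * (4 * P + 8 * q * (1 + Real.log (2 * q))) := by
  have hq' : (1:ℝ) ≤ q := by exact_mod_cast hq
  set s := (q + 1) / 2 with hs
  have hs1 : 0 < s := by omega
  set E := 4 * P + 8 * q * (1 + Real.log (2 * q)) with hE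
  have hE0 : 0 ≤ E := by
    have := Real.log_nonneg (show (1:ℝ) ≤ 2 * q by linarith)
    positivity
  have hmap : ∀ l ∈ Icc 1 Y, l / s ∈ range (Y / s + 1) := by
    intro l hl
    rw [mem_range, Nat.lt_succ_iff]
    exact Nat.div_le_div_right (mem_Icc.1 hl).2
  rw [← sum_fiberwise_of_maps_to hmap]
  calc _ ≤ ∑ t ∈ range (Y / s + 1), E := by
        refine sum_le_sum fun t _ => ?_
        apply block_le q hq P hP _ (fun l => α * l)
        intro i hi j hj hij
        rw [mem_filter] at hi hj
        have h1 := Nat.div_add_mod i s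
        have h2 := Nat.div_add_mod j s
        have h3 := Nat.mod_lt i hs1
        have h4 := Nat.mod_lt j hs1
        rw [hi.2] at h1; rw [hj.2] at h2
        have := spacing α a q hq hc h ((i:ℤ) - j) (by omega) (by
          rw [show (2 * |(i:ℤ) - j|) = |2 * ((i:ℤ) - j)| by rw [abs_mul]; simp, abs_lt]
          constructor <;> omega)
        push_cast at this
        rwa [show α * i - α * j = α * ((i:ℝ) - j) by ring]
    _ = ((Y / s : ℕ) + 1) * E := by simp
    _ ≤ _ := by
        gcongr
        have h1 : ((Y / s : ℕ) : ℝ) ≤ Y / s := Nat.cast_div_le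
        have h2 : (q:ℝ) / 2 ≤ s := by
          have : q ≤ 2 * s := by omega
          have : (q:ℝ) ≤ 2 * s := by exact_mod_cast this
          linarith
        calc ((Y / s : ℕ) : ℝ) ≤ Y / s := h1
          _ ≤ Y / (q / 2) := by gcongr
          _ = _ := by field_simp

end HarmanAux

namespace HarmanAux

/-- multiplicative differencing -/
noncomputable def dd (h : ℤ) (f : ℤ → ℂ) : ℤ → ℂ := fun n => f (n + h) * (starRingEnd ℂ) (f n)

/-- iterated difference sums -/
noncomputable def GG (I H : Finset ℤ) : ℕ → (ℤ → ℂ) → ℂ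
  | 0, f => ∑ n ∈ I, f n
  | j + 1, f => ∑ h ∈ H, GG I H j (dd h f)

/-- sums over products -/
noncomputable def SH (H : Finset ℤ) : ℕ → (ℤ → ℝ) → ℝ
  | 0, F => F 1
  | j + 1, F => ∑ h ∈ H, SH H j (fun x => F (h * x))

lemma GG_one (A L : ℤ) (f : ℤ → ℂ) (hf : ∀ n, n ∉ Icc A (A + L) → f n = 0) :
    GG (Icc A (A+L)) (Icc (-L) L) 1 f = ((‖∑ n ∈ Icc A (A+L), f n‖^2 : ℝ) : ℂ) := by
  have key : ∀ n ∈ Icc A (A+L), ∑ h ∈ Icc (-L) L, f (n + h) = ∑ m ∈ Icc A (A+L), f m := by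
    intro n hn
    rw [mem_Icc] at hn
    have : ∑ h ∈ Icc (-L) L, f (n + h) = ∑ m ∈ Icc (n - L) (n + L), f m := by
      apply sum_bij (fun h _ => n + h)
      · intro h hh; rw [mem_Icc] at *; omega
      · intro h _ h' _ e; simpa using e
      · intro m hm; rw [mem_Icc] at hm; exact ⟨m - n, by rw [mem_Icc]; omega, by ring⟩
      · intros; rfl
    rw [this]
    symm
    apply sum_subset
    · intro m hm; rw [mem_Icc] at *; omega
    · intro m _ hm; exact hf m hm
  simp only [GG, dd]
  rw [sum_comm]
  have : ∀ n ∈ Icc A (A+L), ∑ h ∈ Icc (-L) L, f (n + h) * (starRingEnd ℂ) (f n)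
      = (∑ m ∈ Icc A (A+L), f m) * (starRingEnd ℂ) (f n) := by
    intro n hn; rw [← sum_mul, key n hn]
  rw [sum_congr rfl this, ← mul_sum, ← map_sum, Complex.mul_conj, Complex.normSq_eq_norm_sq]

lemma GG_ineq (A : ℤ) (L : ℕ) (j : ℕ) : ∀ f : ℤ → ℂ, (∀ n, n ∉ Icc A (A + L) → f n = 0) →
    ‖∑ n ∈ Icc A (A+L), f n‖^(2^(j+1)) * ((2 * L + 1 : ℝ))^(j+2) ≤
      (2 * L + 1 : ℝ)^(2^(j+1)) * (GG (Icc A (A+L)) (Icc (-L) L) (j+1) f).re := by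
  induction j with
  | zero =>
    intro f hf
    rw [zero_add, GG_one A L f hf, Complex.ofReal_re]
    apply le_of_eq; ring
  | succ j ih =>
    intro f hf
    set P : ℝ := 2 * L + 1 with hP
    have hP0 : 0 < P := by positivity
    have hsupp : ∀ h, ∀ n, n ∉ Icc A (A + (L:ℤ)) → dd h f n = 0 := by
      intro h n hn; simp [dd, hf n hn]
    have h1 : ‖∑ n ∈ Icc A (A+(L:ℤ)), f n‖^2 ≤
        ∑ h ∈ Icc (-(L:ℤ)) L, ‖∑ n ∈ Icc A (A+(L:ℤ)), dd h f n‖ := by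
      have := GG_one A L f hf
      have h2 : ‖∑ n ∈ Icc A (A+(L:ℤ)), f n‖^2 = ‖GG (Icc A (A+(L:ℤ))) (Icc (-(L:ℤ)) L) 1 f‖ := by
        rw [this, Complex.norm_real, Real.norm_of_nonneg (by positivity)]
      rw [h2]; simp only [GG]; exact norm_sum_le _ _
    have hcard : ((#(Icc (-(L:ℤ)) L) : ℕ) : ℝ) = P := by
      rw [Int.card_Icc, hP]
      have : (((L:ℤ) + 1 - -(L:ℤ)).toNat) = 2 * L + 1 := by omega
      rw [this]; push_cast; ring
    obtain ⟨r, hr⟩ : ∃ r, 2^(j+1) = r + 1 := ⟨2^(j+1) - 1, by have := Nat.one_le_two_pow (n := j+1); omega⟩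
    have h3 : (∑ h ∈ Icc (-(L:ℤ)) L, ‖∑ n ∈ Icc A (A+(L:ℤ)), dd h f n‖)^(2^(j+1)) ≤
        P^r * ∑ h ∈ Icc (-(L:ℤ)) L, ‖∑ n ∈ Icc A (A+(L:ℤ)), dd h f n‖^(2^(j+1)) := by
      rw [hr, ← hcard]
      exact pow_sum_le_card_mul_sum_pow (fun _ _ => norm_nonneg _) r
    calc ‖∑ n ∈ Icc A (A+(L:ℤ)), f n‖^(2^(j+1+1)) * P^(j+1+2)
        = (‖∑ n ∈ Icc A (A+(L:ℤ)), f n‖^2)^(2^(j+1)) * P^(j+1+2) := by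
          rw [← pow_mul]; congr 2; ring
      _ ≤ (P^r * ∑ h ∈ Icc (-(L:ℤ)) L, ‖∑ n ∈ Icc A (A+(L:ℤ)), dd h f n‖^(2^(j+1))) * P^(j+1+2) := by
          gcongr; exact (pow_le_pow_left₀ (by positivity) h1 _).trans h3
      _ = P^(2^(j+1)) * ∑ h ∈ Icc (-(L:ℤ)) L, ‖∑ n ∈ Icc A (A+(L:ℤ)), dd h f n‖^(2^(j+1)) * P^(j+2) := by
          rw [hr, ← sum_mul]; ring
      _ ≤ P^(2^(j+1)) * ∑ h ∈ Icc (-(L:ℤ)) L, P^(2^(j+1)) *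
            (GG (Icc A (A+L)) (Icc (-L) L) (j+1) (dd h f)).re := by
          exact mul_le_mul_of_nonneg_left (sum_le_sum fun h _ => ih _ (hsupp h)) (by positivity)
      _ = P^(2^(j+1+1)) * (GG (Icc A (A+L)) (Icc (-L) L) (j+1+1) f).re := by
          rw [GG, Complex.re_sum, ← mul_sum, ← mul_assoc]; congr 1; ring

/-- one difference step for integer polynomials -/
lemma poly_step (d : ℕ) (q : ℕ → ℤ) (h : ℤ) : ∃ q' : ℕ → ℤ,
    (∀ n : ℤ, (∑ i ∈ range (d+2), q i * (n+h)^i) - ∑ i ∈ range (d+2), q i * n^i =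
      h * ∑ i ∈ range (d+1), q' i * n^i) ∧
    q' d = (d+1) * q (d+1) ∧
    ∀ (B L : ℤ), 0 ≤ B → |h| ≤ L → (∀ i < d+2, |q i| ≤ B * L^(d+1-i)) →
      ∀ i < d+1, |q' i| ≤ (B * ((d+2) * 2^(d+1))) * L^(d-i) := by
  refine ⟨fun r => ∑ i ∈ Ico (r+1) (d+2), q i * (i.choose r) * h^(i-1-r), ?_, ?_, ?_⟩
  · intro n
    have e1 : ∀ i, q i * (n+h)^i - q i * n^i = ∑ r ∈ range i, q i * (i.choose r) * h^(i-r) * n^r := by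
      intro i
      rw [add_pow, sum_range_succ]
      simp only [Nat.sub_self, pow_zero, Nat.choose_self, Nat.cast_one, mul_one]
      rw [mul_add, add_sub_cancel_right, mul_sum]
      refine sum_congr rfl fun r _ => by ring
    rw [← sum_sub_distrib, sum_congr rfl fun i _ => e1 i, mul_sum]
    simp_rw [sum_mul, mul_sum]
    rw [sum_comm' (t' := range (d+1)) (s' := fun r => Ico (r+1) (d+2))]
    · refine sum_congr rfl fun r _ => sum_congr rfl fun i hi => ?_
      rw [mem_Ico] at hi
      have : i - r = (i - 1 - r) + 1 := by omega
      rw [this, pow_succ]; ring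
    · intro x y; simp only [mem_range, mem_Ico]; omega
  · simp; ring
  · intro B L hB hh hq i hi
    have hL : 0 ≤ L := (abs_nonneg h).trans hh
    calc |∑ l ∈ Ico (i+1) (d+2), q l * (l.choose i) * h^(l-1-i)|
        ≤ ∑ l ∈ Ico (i+1) (d+2), |q l * (l.choose i) * h^(l-1-i)| := abs_sum_le_sum_abs _ _
      _ ≤ ∑ l ∈ Ico (i+1) (d+2), B * 2^(d+1) * L^(d-i) := by
          refine sum_le_sum fun l hl => ?_
          rw [mem_Ico] at hl
          rw [abs_mul, abs_mul, abs_pow, Nat.abs_cast]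
          have h1 : ((l.choose i : ℕ) : ℤ) ≤ 2^(d+1) := by
            have : l.choose i ≤ 2^(d+1) :=
              (Nat.choose_le_two_pow l i).trans (Nat.pow_le_pow_right (by norm_num) (by omega))
            exact_mod_cast this
          calc _ ≤ (B * L^(d+1-l)) * 2^(d+1) * L^(l-1-i) := by
                gcongr; exact hq l hl.2
            _ = B * 2^(d+1) * (L^(d+1-l) * L^(l-1-i)) := by ring
            _ = _ := by rw [← pow_add]; congr 2; omega
      _ = ((d+2 - (i+1) : ℕ) : ℤ) * (B * 2^(d+1) * L^(d-i)) := by simp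
      _ ≤ (d + 2) * (B * 2^(d+1) * L^(d-i)) := by
          gcongr
          have : d + 2 - (i+1) ≤ d+2 := by omega
          exact_mod_cast this
      _ = _ := by ring

end HarmanAux

namespace HarmanAux

lemma weyl_rec (A : ℤ) (L : ℕ) (β : ℝ) (j : ℕ) : ∀ (t : ℤ) (q : ℕ → ℤ) (A' B' : ℤ),
    ‖GG (Icc A (A+L)) (Icc (-L) L) j (fun n => if n ∈ Icc A' B' then
        e (β * ((t * ∑ i ∈ range (j+2), q i * n^i : ℤ) : ℝ)) else 0)‖ ≤
      SH (Icc (-L) L) j (fun x => gk (2 * L + 1)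
        (β * ((t * x * ((j+1).factorial * q (j+1)) : ℤ) : ℝ))) := by
  induction j with
  | zero =>
    intro t q A' B'
    simp only [GG, SH]
    rw [← sum_filter]
    have : (Icc A (A+(L:ℤ))).filter (fun n => n ∈ Icc A' B') = Icc (max A A') (min (A+L) B') := by
      ext n; simp only [mem_filter, mem_Icc]; omega
    rw [this]
    have e1 : ∀ n ∈ Icc (max A A') (min (A+(L:ℤ)) B'),
        e (β * ((t * ∑ i ∈ range (0+2), q i * n^i : ℤ) : ℝ)) =
        e (β * t * q 0) * e ((β * t * q 1) * n) := by
      intro n _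
      rw [← e_add]; congr 1
      simp [sum_range_succ]; ring
    rw [sum_congr rfl e1, ← mul_sum, norm_mul, norm_e, one_mul]
    have := geom_le (β * t * q 1) (2 * L + 1) (by positivity) (max A A') (min (A+(L:ℤ)) B') (by
      have : (min (A+(L:ℤ)) B') - (max A A') + 1 ≤ 2 * L + 1 := by omega
      exact_mod_cast this)
    refine this.trans (le_of_eq ?_)
    congr 1; simp; ring
  | succ j ih =>
    intro t q A' B'
    rw [GG, SH]
    refine (norm_sum_le _ _).trans (sum_le_sum fun h hh => ?_)
    obtain ⟨q', hq1, hq2, -⟩ := poly_step (j+1) q h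
    have e1 : dd h (fun n => if n ∈ Icc A' B' then
        e (β * ((t * ∑ i ∈ range (j+1+2), q i * n^i : ℤ) : ℝ)) else 0) =
        (fun n => if n ∈ Icc (max A' (A'-h)) (min B' (B'-h)) then
        e (β * (((t * h) * ∑ i ∈ range (j+2), q' i * n^i : ℤ) : ℝ)) else 0) := by
      funext n
      simp only [dd]
      by_cases c1 : n ∈ Icc A' B'
      · by_cases c2 : n + h ∈ Icc A' B'
        · have c3 : n ∈ Icc (max A' (A'-h)) (min B' (B'-h)) := by
            rw [mem_Icc] at *; omega
          rw [if_pos c1, if_pos c2, if_pos c3, conj_e, ← e_add]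
          congr 1
          rw [mul_assoc t h, ← hq1 n]; push_cast; ring
        · have c3 : n ∉ Icc (max A' (A'-h)) (min B' (B'-h)) := by
            rw [mem_Icc] at *; omega
          rw [if_neg c2, if_neg c3, zero_mul]
      · have c3 : n ∉ Icc (max A' (A'-h)) (min B' (B'-h)) := by
          rw [mem_Icc] at *; omega
        rw [if_neg c1, if_neg c3]; simp
    rw [e1]
    refine (ih (t * h) q' _ _).trans (le_of_eq ?_)
    congr 1; funext x; congr 2
    rw [hq2, Nat.factorial_succ (j+1)]; push_cast; ring

lemma SH_mono (H : Finset ℤ) (j : ℕ) : ∀ F F' : ℤ → ℝ, (∀ x, F x ≤ F' x) → SH H j F ≤ SH H j F' := by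
  induction j with
  | zero => intro F F' h; exact h 1
  | succ j ih => intro F F' h; exact sum_le_sum fun a _ => ih _ _ fun x => h _

lemma typeII_rec (j : ℕ) : ∀ B : ℤ, 0 ≤ B → ∃ R0 : ℕ, 1 ≤ R0 ∧ ∀ (L : ℕ) (M k : ℕ) (α : ℝ) (W : ℤ → ℝ)
    (_ : ∀ c, 0 ≤ W c)
    (_ : ∀ c : ℤ, ∀ X ≤ M, ‖∑ m ∈ Icc 1 X, e (α * (m:ℝ)^k * c)‖ ≤ W c)
    (b : ℤ → ℂ) (Bb : ℝ) (_ : ∀ n, ‖b n‖ ≤ Bb) (φ : ℤ → ℕ) (t : ℤ) (q : ℕ → ℤ)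
    (_ : ∀ i < j + 2, |q i| ≤ B * (L:ℤ)^(j+1-i)) (_ : q (j+1) ≠ 0),
    ‖∑ m ∈ Icc 1 M, GG (Icc (L:ℤ) (L+L)) (Icc (-L) L) j (fun n => b n * (if m ≤ φ n then 1 else 0) *
        e (α * (m:ℝ)^k * ((t * ∑ i ∈ range (j+2), q i * n^i : ℤ) : ℝ)))‖ ≤
      Bb^(2^j) * SH (Icc (-L) L) j (fun x => ∑ u ∈ Icc (-(R0 * L : ℤ)) (R0 * L), W (t * x * u)) := by
  induction j with
  | zero =>
    intro B hB
    refine ⟨(3 * B).toNat + 1, by omega, ?_⟩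
    intro L M k α W hW0 hW b Bb hb φ t q hq hq1
    simp only [GG, SH]
    rw [sum_comm]
    set Q : ℤ → ℤ := fun n => ∑ i ∈ range (0+2), q i * n^i with hQ
    have hQe : ∀ n, Q n = q 0 + q 1 * n := by intro n; simp [hQ, sum_range_succ]
    have hBb : 0 ≤ Bb := (norm_nonneg _).trans (hb 0)
    have e1 : ∀ n ∈ Icc (L:ℤ) (L+L), ‖∑ m ∈ Icc 1 M, b n * (if m ≤ φ n then 1 else 0) *
        e (α * (m:ℝ)^k * ((t * Q n : ℤ) : ℝ))‖ ≤ Bb * W (t * Q n) := by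
      intro n _
      have : ∑ m ∈ Icc 1 M, b n * (if m ≤ φ n then 1 else 0) *
        e (α * (m:ℝ)^k * ((t * Q n : ℤ) : ℝ)) =
        b n * ∑ m ∈ Icc 1 (min M (φ n)), e (α * (m:ℝ)^k * ((t * Q n : ℤ) : ℝ)) := by
        have h2 : Icc 1 (min M (φ n)) = (Icc 1 M).filter (fun m => m ≤ φ n) := by
          ext m; simp only [mem_filter, mem_Icc]; omega
        rw [h2, sum_filter, Finset.mul_sum (Icc 1 M)]
        apply sum_congr rfl
        intro m _
        split_ifs <;> simp
      rw [this, norm_mul]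
      exact mul_le_mul (hb n) (hW _ _ (min_le_left _ _)) (norm_nonneg _) hBb
    refine (norm_sum_le _ _).trans ((sum_le_sum e1).trans ?_)
    rw [← mul_sum, pow_zero, pow_one]
    refine mul_le_mul_of_nonneg_left ?_ hBb
    have hinj : Set.InjOn Q (Icc (L:ℤ) (L+L)) := by
      intro x _ y _ hxy
      rw [hQe, hQe] at hxy
      have : q 1 * x = q 1 * y := by linarith
      exact mul_left_cancel₀ hq1 this
    simp only [mul_one]
    have himg := sum_image (f := fun u : ℤ => W (t * u)) hinj
    rw [show ∑ i ∈ Icc (L:ℤ) (L+L), W (t * Q i) = ∑ u ∈ (Icc (L:ℤ) (L+L)).image Q, W (t * u) from himg.symm]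
    apply sum_le_sum_of_subset_of_nonneg
    · intro u hu
      obtain ⟨n, hn, rfl⟩ := mem_image.1 hu
      rw [mem_Icc] at hn
      have b0 := hq 0 (by norm_num)
      have b1 := hq 1 (by norm_num)
      simp only [zero_add, Nat.sub_self, pow_zero, mul_one, Nat.sub_zero, pow_one] at b0 b1
      rw [mem_Icc, ← abs_le, hQe]
      have hn0 : |n| ≤ 2 * L := by rw [abs_le]; omega
      calc |q 0 + q 1 * n| ≤ |q 0| + |q 1| * |n| := by rw [← abs_mul]; exact abs_add_le _ _
        _ ≤ B * L + B * (2 * L) := by gcongr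
        _ = (3 * B) * L := by ring
        _ ≤ _ := by gcongr; push_cast; omega
    · intro u _ _; exact hW0 _
  | succ j ih =>
    intro B hB
    obtain ⟨R0, hR0, ih⟩ := ih (B * (((j+1:ℕ)+2) * 2^((j+1)+1))) (by positivity)
    refine ⟨R0, hR0, ?_⟩
    intro L M k α W hW0 hW b Bb hb φ t q hq hq1
    simp only [GG]
    rw [sum_comm, SH, mul_sum]
    refine (norm_sum_le _ _).trans (sum_le_sum fun h hh => ?_)
    obtain ⟨q', hq1', hq2, hq3⟩ := poly_step (j+1) q h
    have e1 : ∀ m : ℕ, dd h (fun n => b n * (if m ≤ φ n then 1 else 0) *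
        e (α * (m:ℝ)^k * ((t * ∑ i ∈ range (j+1+2), q i * n^i : ℤ) : ℝ))) =
        (fun n => (b (n+h) * (starRingEnd ℂ) (b n)) *
          (if m ≤ min (φ (n+h)) (φ n) then 1 else 0) *
        e (α * (m:ℝ)^k * (((t * h) * ∑ i ∈ range (j+2), q' i * n^i : ℤ) : ℝ))) := by
      intro m
      funext n
      simp only [dd, map_mul, conj_e]
      have e2 : e (α * (m:ℝ)^k * (((t * h) * ∑ i ∈ range (j+2), q' i * n^i : ℤ) : ℝ)) =
          e (α * (m:ℝ)^k * ((t * ∑ i ∈ range (j+1+2), q i * (n+h)^i : ℤ) : ℝ)) *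
          e (-(α * (m:ℝ)^k * ((t * ∑ i ∈ range (j+1+2), q i * n^i : ℤ) : ℝ))) := by
        rw [← e_add]; congr 1
        rw [mul_assoc t h, ← hq1' n]; push_cast; ring
      rw [e2]
      have e3 : (if m ≤ min (φ (n+h)) (φ n) then (1:ℂ) else 0) =
        (if m ≤ φ (n+h) then (1:ℂ) else 0) * (starRingEnd ℂ) (if m ≤ φ n then (1:ℂ) else 0) := by
        by_cases c1 : m ≤ φ (n+h) <;> by_cases c2 : m ≤ φ n <;> simp [c1, c2]
      rw [e3]; ring
    have hh' : |h| ≤ (L:ℤ) := by rw [mem_Icc] at hh; rw [abs_le]; omega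
    have := ih L M k α W hW0 hW (fun n => b (n+h) * (starRingEnd ℂ) (b n)) (Bb * Bb) (by
        intro n
        rw [norm_mul, RCLike.norm_conj]
        exact mul_le_mul (hb _) (hb _) (norm_nonneg _) ((norm_nonneg _).trans (hb 0)))
      (fun n => min (φ (n+h)) (φ n)) (t * h) q' (fun i hi => hq3 B L hB hh' hq i hi) (by
        rw [hq2]; exact mul_ne_zero (by positivity) hq1)
    simp only [e1]
    refine this.trans (le_of_eq ?_)
    rw [← pow_two, ← pow_mul]
    congr 1
    · congr 1; ring
    · congr 1; funext x; refine sum_congr rfl fun u _ => ?_; congr 1; ring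

end HarmanAux

namespace HarmanAux

lemma SH_nonneg (H : Finset ℤ) (j : ℕ) : ∀ F : ℤ → ℝ, (∀ x, 0 ≤ F x) → 0 ≤ SH H j F := by
  induction j with
  | zero => intro F h; exact h 1
  | succ j ih => intro F h; exact sum_nonneg fun a _ => ih _ fun x => h _

lemma SH_const (H : Finset ℤ) (j : ℕ) (c : ℝ) : SH H j (fun _ => c) = (#H : ℝ)^j * c := by
  induction j with
  | zero => simp [SH]
  | succ j ih => rw [SH]; simp only [ih]; simp; ring

lemma div_step (T : ℝ) (Z M : ℕ)
    (hd : ∀ l, 1 ≤ l → l ≤ Z * M → (#(Nat.divisors l) : ℝ) ≤ T)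
    (Φ : ℕ → ℝ) (hΦ : ∀ x, 0 ≤ Φ x) :
    ∑ c ∈ Icc 1 Z, ∑ h ∈ Icc 1 M, Φ (c * h) ≤ T * ∑ l ∈ Icc 1 (Z * M), Φ l := by
  rw [← sum_product']
  have hmap : ∀ x ∈ Icc 1 Z ×ˢ Icc 1 M, x.1 * x.2 ∈ Icc 1 (Z * M) := by
    intro x hx
    rw [mem_product, mem_Icc, mem_Icc] at hx
    rw [mem_Icc]
    exact ⟨Nat.mul_pos hx.1.1 hx.2.1, Nat.mul_le_mul hx.1.2 hx.2.2⟩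
  rw [← sum_fiberwise_of_maps_to hmap, mul_sum]
  refine sum_le_sum fun l hl => ?_
  rw [mem_Icc] at hl
  have e1 : ∀ x ∈ (Icc 1 Z ×ˢ Icc 1 M).filter (fun x => x.1 * x.2 = l), Φ (x.1 * x.2) = Φ l := by
    intro x hx; rw [(mem_filter.1 hx).2]
  rw [sum_congr rfl e1, sum_const, nsmul_eq_mul]
  refine mul_le_mul_of_nonneg_right ?_ (hΦ l)
  refine le_trans ?_ (hd l hl.1 hl.2)
  rw [Nat.cast_le]
  apply card_le_card_of_injOn (fun x => x.1)
  · intro x hx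
    have hx := (mem_filter.1 hx).2
    exact Nat.mem_divisors.2 ⟨⟨x.2, hx.symm⟩, by omega⟩
  · intro x hx y hy hxy
    have hx1 := (mem_filter.1 hx).2
    have hy1 := (mem_filter.1 hy).2
    simp only at hxy
    have hx0 : x.1 ≠ 0 := by
      rintro h; rw [h] at hx1; omega
    refine Prod.ext hxy ?_
    rw [← hy1, ← hxy] at hx1
    exact Nat.eq_of_mul_eq_mul_left (Nat.pos_of_ne_zero hx0) hx1

lemma sum_sym (M : ℕ) (Φ : ℤ → ℝ) (hev : ∀ x, Φ (-x) = Φ x) :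
    ∑ h ∈ Icc (-(M:ℤ)) M, Φ h = Φ 0 + 2 * ∑ h ∈ Icc 1 M, Φ (h:ℕ) := by
  induction M with
  | zero => simp
  | succ M ih =>
    have : Icc (-((M+1:ℕ):ℤ)) (M+1:ℕ) = insert (-((M+1:ℕ):ℤ)) (insert ((M+1:ℕ):ℤ) (Icc (-(M:ℤ)) M)) := by
      ext x; simp only [mem_insert, mem_Icc]; push_cast; omega
    rw [this, sum_insert, sum_insert, ih, hev, sum_Icc_succ_top (by omega)]
    · ring
    · simp
    · simp only [mem_insert, mem_Icc]; push_cast; omega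

lemma count (M : ℕ) (hM : 1 ≤ M) (T : ℝ) (hT : 1 ≤ T) (Y0 : ℕ)
    (hd : ∀ l, 1 ≤ l → l ≤ Y0 → (#(Nat.divisors l) : ℝ) ≤ T) (F : ℤ → ℝ)
    (hF : ∀ x, 0 ≤ F x) (hev : ∀ x, F (-x) = F x) (j : ℕ) : ∀ Z : ℕ, Z * M^j ≤ Y0 →
    ∑ c ∈ Icc 1 Z, SH (Icc (-(M:ℤ)) M) j (fun x => F ((c:ℕ) * x)) ≤
      (2 * T)^j * (j * Z * (2 * M + 1)^j / (2 * M + 1) * F 0 + ∑ l ∈ Icc 1 (Z * M^j), F (l:ℕ)) := by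
  induction j with
  | zero => intro Z _; simp [SH]
  | succ j ih =>
    intro Z hZ
    set P : ℝ := 2 * M + 1 with hP
    have hP0 : 0 < P := by positivity
    have hP1 : 1 ≤ P := by rw [hP]; have : (0:ℝ) ≤ M := by positivity
                           linarith
    have hcard : ((#(Icc (-(M:ℤ)) M) : ℕ) : ℝ) = P := by
      rw [Int.card_Icc, hP]
      have : (((M:ℤ) + 1 - -(M:ℤ)).toNat) = 2 * M + 1 := by omega
      rw [this]; push_cast; ring
    set Φ : ℤ → ℝ := fun y => SH (Icc (-(M:ℤ)) M) j (fun x => F (y * x)) with hΦ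
    have hΦ0 : ∀ y, 0 ≤ Φ y := fun y => SH_nonneg _ _ _ fun x => hF _
    have hΦe : ∀ y, Φ (-y) = Φ y := by
      intro y; simp only [hΦ]; congr 1; funext x; rw [neg_mul, hev]
    have hΦz : Φ 0 = P^j * F 0 := by
      simp only [hΦ, zero_mul]; rw [SH_const, hcard]
    have e1 : ∀ c ∈ Icc 1 Z, SH (Icc (-(M:ℤ)) M) (j+1) (fun x => F ((c:ℕ) * x)) =
        P^j * F 0 + 2 * ∑ h ∈ Icc 1 M, Φ ((c * h : ℕ) : ℤ) := by
      intro c _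
      rw [SH]
      have := sum_sym M (fun h => Φ (c * h)) (by intro x; rw [mul_neg, hΦe])
      rw [mul_zero, hΦz] at this
      push_cast
      rw [← this]
      refine sum_congr rfl fun h _ => ?_
      simp only [hΦ, mul_assoc]
    have hZM : Z * M ≤ Y0 := by
      refine le_trans ?_ hZ
      refine Nat.mul_le_mul_left _ ?_
      exact Nat.le_self_pow (by omega) M
    have h2 := div_step T Z M (fun l h1 h2 => hd l h1 (h2.trans hZM)) (fun n => Φ (n:ℕ)) (fun _ => hΦ0 _)
    have h3 := ih (Z * M) (by rw [mul_assoc, ← pow_succ']; exact hZ)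
    have hsum0 : 0 ≤ ∑ l ∈ Icc 1 (Z * M * M^j), F (l:ℕ) := sum_nonneg fun _ _ => hF _
    rw [sum_congr rfl e1, sum_add_distrib, sum_const, nsmul_eq_mul, Nat.card_Icc, ← mul_sum]
    have hT2 : 1 ≤ (2*T)^(j+1) := one_le_pow₀ (by linarith)
    have hMP : (M:ℝ) ≤ P := by rw [hP]; have : (0:ℝ) ≤ M := by positivity
                               linarith
    have hF0 := hF 0
    rw [show Z * M^(j+1) = Z * M * M^j by rw [pow_succ']; ring]
    calc ((Z + 1 - 1 : ℕ) : ℝ) * (P^j * F 0) + 2 * ∑ c ∈ Icc 1 Z, ∑ h ∈ Icc 1 M, Φ ((c * h : ℕ) : ℤ)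
        ≤ 1 * (Z * (P^j * F 0)) + 2 * (T * ((2 * T)^j * (j * ((Z * M : ℕ):ℝ) * P^j / P * F 0 +
            ∑ l ∈ Icc 1 (Z * M * M^j), F (l:ℕ)))) := by
          rw [one_mul]
          refine add_le_add (by simp) ?_
          gcongr
          refine h2.trans ?_
          gcongr
      _ ≤ (2*T)^(j+1) * (Z * (P^j * F 0)) + 2 * (T * ((2 * T)^j * (j * (Z * P) * P^j / P * F 0 +
            ∑ l ∈ Icc 1 (Z * M * M^j), F (l:ℕ)))) := by
          push_cast
          gcongr
      _ = _ := by
          push_cast; field_simp; ring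

lemma weyl_bound (j M : ℕ) (α : ℝ) (c : ℤ) (X : ℕ) (hX : X ≤ M) :
    ‖∑ m ∈ Icc 1 X, e (α * (m:ℝ)^(j+2) * c)‖^(2^(j+1)) * (2 * M + 1 : ℝ)^(j+2) ≤
      (2 * M + 1 : ℝ)^(2^(j+1)) * SH (Icc (-(M:ℤ)) M) (j+1) (fun x =>
        gk (2 * M + 1) (α * ((c * x * ((j+2).factorial : ℤ) : ℤ) : ℝ))) := by
  set q : ℕ → ℤ := fun i => if i = j + 2 then 1 else 0 with hq
  set f : ℤ → ℂ := (fun n => if n ∈ Icc (1:ℤ) X then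
        e (α * ((c * ∑ i ∈ range (j+1+2), q i * n^i : ℤ) : ℝ)) else 0) with hf
  have hQ : ∀ n : ℤ, ∑ i ∈ range (j+1+2), q i * n^i = n^(j+2) := by
    intro n; simp [hq]
  have h1 := weyl_rec 0 M α (j+1) c q 1 X
  have h2 := GG_ineq 0 M j f (by
    intro n hn
    simp only [hf]
    rw [if_neg]
    intro h; apply hn; rw [mem_Icc] at *; omega)
  have h3 : ∑ n ∈ Icc (0:ℤ) (0+M), f n = ∑ m ∈ Icc 1 X, e (α * (m:ℝ)^(j+2) * c) := by
    simp only [hf]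
    rw [← sum_filter]
    symm
    apply sum_bij (fun (m:ℕ) _ => (m:ℤ))
    · intro m hm; rw [mem_Icc] at hm; rw [mem_filter, mem_Icc, mem_Icc]; omega
    · intro a _ b _ h; exact_mod_cast h
    · intro b hb
      rw [mem_filter, mem_Icc, mem_Icc] at hb
      exact ⟨b.toNat, by rw [mem_Icc]; omega, by omega⟩
    · intro m _
      rw [hQ]; push_cast; congr 1; ring
  rw [h3] at h2
  refine h2.trans ?_
  gcongr
  refine (Complex.re_le_norm _).trans (h1.trans (le_of_eq ?_))
  congr 1; funext x; congr 3; simp [hq]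

end HarmanAux

namespace HarmanAux

lemma weyl_pack (j : ℕ) : ∃ C : ℝ, 1 ≤ C ∧ ∀ (α : ℝ) (a : ℤ) (q : ℕ), 0 < q → Int.gcd a (q : ℤ) = 1 →
    |α - (a : ℝ) / (q : ℝ)| < 1/(q:ℝ)^2 → ∀ (T : ℝ) (Y0 : ℕ), 1 ≤ T →
    (∀ l, 1 ≤ l → l ≤ Y0 → (#(Nat.divisors l) : ℝ) ≤ T) → 1 + Real.log (2 * q) ≤ T →
    ∀ (M : ℕ) (D : ℝ), 1 ≤ M → 1 / (q:ℝ) ≤ D → 1 ≤ (2 * M + 1 : ℝ) * D →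
    ∃ W : ℤ → ℝ, (∀ c, 0 ≤ W c) ∧ (∀ c, W (-c) = W c) ∧ W 0 ≤ M ∧
      (∀ c : ℤ, ∀ X ≤ M, ‖∑ m ∈ Icc 1 X, e (α * (m:ℝ)^(j+2) * c)‖ ≤ W c) ∧
      ∀ Z : ℕ, 1 ≤ Z → Z * M^(j+1) ≤ Y0 → (q:ℝ) ≤ Z * (2 * M + 1 : ℝ)^(j+2) * D →
        ∑ c ∈ Icc 1 Z, (W (c:ℕ))^(2^(j+1)) ≤
          C * T^(j+2) * (2 * M + 1 : ℝ)^(2^(j+1)) * Z * D := by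
  set f := (j+2).factorial with hf
  have hf1 : 1 ≤ f := Nat.factorial_pos _
  refine ⟨2^(j+1) * (2 * (j+1) + 24 * f + 12), ?_, ?_⟩
  · have : (1:ℝ) ≤ 2^(j+1) := one_le_pow₀ (by norm_num)
    have : (0:ℝ) ≤ j := by positivity
    have : (0:ℝ) ≤ f := by positivity
    nlinarith
  intro α a q hq hc hα T Y0 hT hd hTq M D hM hqD hPD
  set P : ℝ := 2 * M + 1 with hP
  have hMP : (M:ℝ) ≤ P := by
    rw [hP]; have : (0:ℝ) ≤ M := by positivity
    linarith
  have hP1 : 1 ≤ P := by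
    rw [hP]; have : (0:ℝ) ≤ M := by positivity
    linarith
  have hP0 : 0 < P := by linarith
  set K := 2^(j+1) with hK
  have hK0 : K ≠ 0 := by rw [hK]; positivity
  set S : ℤ → ℝ := fun c => SH (Icc (-(M:ℤ)) M) (j+1) (fun x =>
        gk P (α * ((c * x * (f : ℤ) : ℤ) : ℝ))) with hS
  have hS0 : ∀ c, 0 ≤ S c := fun c => SH_nonneg _ _ _ fun x => gk_nonneg hP0 _
  have hSe : ∀ c, S (-c) = S c := by
    intro c; simp only [hS]; congr 1; funext x
    rw [← gk_neg]; congr 1; push_cast; ring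
  set Bc : ℤ → ℝ := fun c => P^K / P^(j+2) * S c with hBc
  have hB0 : ∀ c, 0 ≤ Bc c := fun c => by have := hS0 c; positivity
  refine ⟨fun c => if c = 0 then (M:ℝ) else (Bc c)^((K:ℝ)⁻¹), ?_, ?_, ?_, ?_, ?_⟩
  · intro c
    dsimp only
    split_ifs
    · positivity
    · exact Real.rpow_nonneg (hB0 c) _
  · intro c
    simp only [neg_eq_zero, hBc, hSe]
  · simp
  · intro c X hX
    dsimp only
    split_ifs with h0
    · refine (norm_sum_le _ _).trans ?_
      simp only [norm_e, sum_const, Nat.card_Icc, nsmul_eq_mul, mul_one]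
      exact_mod_cast (by omega : X + 1 - 1 ≤ M)
    · have h1 := weyl_bound j M α c X hX
      have h2 : ‖∑ m ∈ Icc 1 X, e (α * (m:ℝ)^(j+2) * c)‖^K ≤ Bc c := by
        simp only [hBc]
        rw [div_mul_eq_mul_div, le_div_iff₀ (by positivity)]
        exact h1
      rw [Real.le_rpow_inv_iff_of_pos (norm_nonneg _) (hB0 c) (by positivity), Real.rpow_natCast]
      exact h2
  · intro Z hZ hZY hqZ
    have e1 : ∀ c ∈ Icc 1 Z, (if (((c:ℕ):ℤ)) = 0 then (M:ℝ) else (Bc (c:ℕ))^((K:ℝ)⁻¹))^K = P^K / P^(j+2) * S (c:ℕ) := by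
      intro c hc
      rw [mem_Icc] at hc
      rw [if_neg (by omega), Real.rpow_inv_natCast_pow (hB0 _) hK0]
    rw [sum_congr rfl e1, ← mul_sum]
    have h1 := count M hM T hT Y0 hd (fun x => gk P (α * ((x * (f:ℤ) : ℤ) : ℝ)))
      (fun x => gk_nonneg hP0 _) (by intro x; rw [← gk_neg]; congr 1; push_cast; ring) (j+1) Z hZY
    have h2 : ∑ l ∈ Icc 1 (Z * M^(j+1)), gk P (α * ((((l:ℕ):ℤ) * (f:ℤ) : ℤ) : ℝ)) ≤
        ∑ l ∈ Icc 1 (f * (Z * M^(j+1))), gk P (α * (l:ℕ)) := by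
      have hinj : Set.InjOn (fun l : ℕ => l * f) (Icc 1 (Z * M^(j+1))) := by
        intro x _ y _ h
        exact Nat.eq_of_mul_eq_mul_right hf1 h
      have himg := sum_image (f := fun l : ℕ => gk P (α * (l:ℕ))) hinj
      have : ∑ l ∈ Icc 1 (Z * M^(j+1)), gk P (α * ((((l:ℕ):ℤ) * (f:ℤ) : ℤ) : ℝ)) =
        ∑ l ∈ Icc 1 (Z * M^(j+1)), gk P (α * ((l * f : ℕ):ℝ)) := by
        refine sum_congr rfl fun l _ => ?_
        push_cast; rfl
      rw [this, ← himg]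
      apply sum_le_sum_of_subset_of_nonneg
      · intro l hl
        obtain ⟨x, hx, rfl⟩ := mem_image.1 hl
        rw [mem_Icc] at *
        exact ⟨Nat.mul_pos hx.1 hf1, by rw [mul_comm f]; exact Nat.mul_le_mul_right _ hx.2⟩
      · intro l _ _; exact gk_nonneg hP0 _
    have h3 := sum_gk_le α a q hq hc hα P hP0 (f * (Z * M^(j+1)))
    have hq' : (0:ℝ) < q := by exact_mod_cast hq
    have hD : 0 < D := lt_of_lt_of_le (by positivity) hqD
    have hZ' : (1:ℝ) ≤ Z := by exact_mod_cast hZ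
    have hMj : (M:ℝ)^(j+1) ≤ P^(j+1) := by gcongr
    set Q := Z * P^(j+2) * D with hQ
    have hQ0 : 0 < Q := by positivity
    have hZP : Z * P^(j+1) ≤ Q := by
      calc Z * P^(j+1) = Z * P^(j+1) * 1 := by ring
        _ ≤ Z * P^(j+1) * (P * D) := by gcongr
        _ = Q := by rw [hQ]; ring
    have hPQ : P ≤ Q := by
      refine le_trans ?_ hZP
      calc P = 1 * P^1 := by ring
        _ ≤ Z * P^(j+1) := by gcongr; omega
    have h4 : (2 * ((f * (Z * M^(j+1)) : ℕ) : ℝ) / q + 1) * (4 * P + 8 * q * (1 + Real.log (2 * q))) ≤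
        (24 * f + 12) * T * Q := by
      calc _ ≤ (2 * (f * (Z * P^(j+1))) / q + 1) * (4 * P + 8 * q * T) := by
            push_cast
            have : 0 ≤ 4 * P + 8 * q * (1 + Real.log (2 * q)) := by
              have := Real.log_nonneg (show (1:ℝ) ≤ 2 * q by
                have : (1:ℝ) ≤ q := by exact_mod_cast hq
                linarith)
              positivity
            gcongr
        _ = 8 * f * (Z * P^(j+1) * P * (1 / q)) + 16 * f * T * (Z * P^(j+1)) + 4 * P + 8 * T * q := by
            field_simp; ring
        _ ≤ 8 * f * (Z * P^(j+1) * P * D) + 16 * f * T * Q + 4 * Q + 8 * T * Q := by gcongr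
        _ = 8 * f * 1 * Q + 16 * f * T * Q + 4 * 1 * Q + 8 * T * Q := by rw [hQ]; ring
        _ ≤ 8 * f * T * Q + 16 * f * T * Q + 4 * T * Q + 8 * T * Q := by gcongr
        _ = _ := by ring
    have h5 : ∑ c ∈ Icc 1 Z, S (c:ℕ) ≤ (2*T)^(j+1) * ((2 * (j+1)) * T * Q + (24 * f + 12) * T * Q) := by
      have : ∑ c ∈ Icc 1 Z, S (c:ℕ) = ∑ c ∈ Icc 1 Z, SH (Icc (-(M:ℤ)) M) (j+1) (fun x =>
          (fun x => gk P (α * ((x * (f:ℤ) : ℤ) : ℝ))) ((c:ℕ) * x)) := rfl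
      rw [this]
      refine h1.trans ?_
      have hg : gk P (α * ((0 * (f:ℤ) : ℤ) : ℝ)) = 2 * P := by simp [gk_zero]
      rw [hg]
      refine mul_le_mul_of_nonneg_left (add_le_add ?_ (h2.trans (h3.trans h4))) (by positivity)
      rw [← hP]
      calc ((j+1 : ℕ) : ℝ) * Z * P^(j+1) / P * (2 * P) = (2 * (j+1)) * 1 * (Z * P^(j+1)) := by
              push_cast; field_simp
          _ ≤ _ := by gcongr
    calc P^K / P^(j+2) * ∑ c ∈ Icc 1 Z, S (c:ℕ) ≤
        P^K / P^(j+2) * ((2*T)^(j+1) * ((2 * (j+1)) * T * Q + (24 * f + 12) * T * Q)) := by gcongr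
      _ = _ := by
        rw [hQ]; field_simp; rw [mul_pow]; ring

end HarmanAux

namespace HarmanAux

lemma divisor_bound (ε : ℝ) (hε : 0 < ε) : ∃ C : ℝ, 1 ≤ C ∧ ∀ n : ℕ, 1 ≤ n →
    (#(Nat.divisors n) : ℝ) ≤ C * (n:ℝ)^ε := by
  set A : ℝ := 1 + 1 / (ε * Real.log 2) with hA
  have hl2 : 0 < Real.log 2 := Real.log_pos (by norm_num)
  have hA1 : 1 ≤ A := by rw [hA]; have : 0 < 1 / (ε * Real.log 2) := by positivity
                         linarith
  set R : ℕ := ⌈(2:ℝ)^(1/ε)⌉₊ with hR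
  refine ⟨A^R, one_le_pow₀ hA1, ?_⟩
  intro n hn
  rw [Nat.card_divisors (by omega)]
  push_cast
  have key : ∀ p ∈ n.primeFactors, ((n.factorization p : ℝ) + 1) ≤
      (if p < R then A else 1) * ((p:ℝ)^(n.factorization p))^ε := by
    intro p hp
    have hpp := Nat.prime_of_mem_primeFactors hp
    have hp2 : (2:ℝ) ≤ p := by exact_mod_cast hpp.two_le
    set v := n.factorization p
    have hpv : ((p:ℝ)^v)^ε = ((p:ℝ)^ε)^v := by
      rw [← Real.rpow_natCast, ← Real.rpow_natCast, ← Real.rpow_mul (by positivity), ← Real.rpow_mul (by positivity), mul_comm]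
    split_ifs with h
    · have h1 : ((2:ℝ)^v)^ε ≤ ((p:ℝ)^v)^ε := by gcongr
      have h2 : 1 + ε * Real.log 2 * v ≤ ((2:ℝ)^v)^ε := by
        rw [← Real.rpow_natCast, ← Real.rpow_mul (by positivity), Real.rpow_def_of_pos (by norm_num)]
        have := Real.add_one_le_exp (Real.log 2 * (v * ε))
        linarith
      have h3 : (v:ℝ) + 1 ≤ A * (1 + ε * Real.log 2 * v) := by
        rw [hA]
        have h4 : (1 + 1 / (ε * Real.log 2)) * (1 + ε * Real.log 2 * v) = 1 + v + (ε * Real.log 2 * v + 1 / (ε * Real.log 2)) := by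
          field_simp; ring
        rw [h4]
        have : 0 ≤ (ε * Real.log 2 * v + 1 / (ε * Real.log 2)) := by positivity
        linarith
      calc (v:ℝ) + 1 ≤ A * (1 + ε * Real.log 2 * v) := h3
        _ ≤ A * ((p:ℝ)^v)^ε := by gcongr; exact h2.trans h1
    · rw [hpv, one_mul]
      have h1 : (2:ℝ)^(1/ε) ≤ p := (Nat.le_ceil _).trans (by exact_mod_cast not_lt.1 h)
      have h2 : (2:ℝ) ≤ (p:ℝ)^ε := by
        calc (2:ℝ) = ((2:ℝ)^(1/ε))^ε := by
              rw [← Real.rpow_mul (by norm_num)]; rw [one_div, inv_mul_cancel₀ hε.ne', Real.rpow_one]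
          _ ≤ _ := by gcongr
      have h3 : ((v + 1 : ℕ):ℝ) ≤ ((2^v : ℕ) : ℝ) := by exact_mod_cast Nat.lt_two_pow_self
      calc (v:ℝ)+1 ≤ 2^v := by push_cast at h3; exact h3
        _ ≤ _ := by gcongr
  refine (prod_le_prod (fun i _ => by positivity) key).trans ?_
  rw [prod_mul_distrib]
  have hn' : ∏ p ∈ n.primeFactors, ((p:ℝ)^(n.factorization p))^ε = (n:ℝ)^ε := by
    rw [Real.finsetProd_rpow _ _ (fun i _ => by positivity)]
    congr 1
    have := Nat.prod_factorization_pow_eq_self (n := n) (by omega)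
    conv_rhs => rw [← this]
    rw [Finsupp.prod, Nat.support_factorization]; push_cast; rfl
  rw [hn']
  gcongr
  rw [prod_ite]
  simp only [prod_const, one_pow, mul_one]
  apply pow_le_pow_right₀ hA1
  calc _ ≤ #(range R) := card_le_card (by intro x hx; rw [mem_filter] at hx; exact mem_range.2 hx.2)
    _ = R := card_range R

end HarmanAux

namespace HarmanAux

structure Ctx (j : ℕ) (α : ℝ) (a : ℤ) (q N : ℕ) (δ T : ℝ) (Y0 : ℕ) : Prop where
  hq : 0 < q
  hc : Int.gcd a (q : ℤ) = 1
  hα : |α - (a : ℝ) / (q : ℝ)| < 1/(q:ℝ)^2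
  hN : 1 ≤ N
  hδ0 : 0 < δ
  hδ1 : δ ≤ 1
  hqD : 1 / (q:ℝ) ≤ δ^(2^(j+1) * 2^(j+1))
  hND : 1 ≤ (N:ℝ) * (δ^(2^(j+1) * 2^(j+1)))^2
  hqN : (q:ℝ) ≤ (N:ℝ)^(j+2) * δ^(2^(j+1) * 2^(j+1))
  hT : 1 ≤ T
  hd : ∀ l, 1 ≤ l → l ≤ Y0 → (#(Nat.divisors l) : ℝ) ≤ T
  hTq : 1 + Real.log (2 * q) ≤ T
  hTN : (Nat.log 2 N : ℝ) + 1 ≤ T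
  hTl : Real.log N ≤ T

lemma pow_mean {ι : Type*} (s : Finset ι) (f : ι → ℝ) (hf : ∀ i ∈ s, 0 ≤ f i) (K : ℕ) (hK : K ≠ 0) :
    (∑ i ∈ s, f i)^K * #s ≤ (#s:ℝ)^K * ∑ i ∈ s, f i^K := by
  obtain ⟨n, rfl⟩ := Nat.exists_eq_succ_of_ne_zero hK
  have := pow_sum_le_card_mul_sum_pow hf n
  calc _ ≤ ((#s:ℝ)^n * ∑ i ∈ s, f i^(n+1)) * #s := by gcongr
    _ = _ := by rw [Nat.succ_eq_add_one]; ring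

lemma root_le {x c y : ℝ} {K : ℕ} (hK : K ≠ 0) (hc : 1 ≤ c) (hy : 0 ≤ y)
    (h : x^K ≤ c * y^K) : x ≤ c * y := by
  have hcy : 0 ≤ c * y := by positivity
  refine le_of_pow_le_pow_left₀ hK hcy (h.trans ?_)
  rw [mul_pow]
  gcongr
  exact le_self_pow₀ hc hK

lemma SH_sum {ι : Type*} (H : Finset ℤ) (s : Finset ι) : ∀ (j : ℕ) (F : ι → ℤ → ℝ),
    SH H j (fun x => ∑ i ∈ s, F i x) = ∑ i ∈ s, SH H j (F i)
  | 0, F => by simp [SH]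
  | j+1, F => by
    simp only [SH]
    rw [sum_comm]
    refine sum_congr rfl fun h _ => ?_
    exact SH_sum H s j (fun i x => F i (h * x))

lemma pack2 (j : ℕ) : ∃ C : ℝ, 1 ≤ C ∧ ∀ (α : ℝ) (a : ℤ) (q N : ℕ) (δ T : ℝ) (Y0 : ℕ),
    Ctx j α a q N δ T Y0 → ∀ M : ℕ, 1 ≤ M → 1 ≤ (2 * M + 1 : ℝ) * δ^(2^(j+1) * 2^(j+1)) →
    ∃ W : ℤ → ℝ, (∀ c, 0 ≤ W c) ∧ (∀ c, W (-c) = W c) ∧ W 0 ≤ M ∧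
      (∀ c : ℤ, ∀ X ≤ M, ‖∑ m ∈ Icc 1 X, e (α * (m:ℝ)^(j+2) * c)‖ ≤ W c) ∧
      ∀ Z : ℕ, 1 ≤ Z → Z * M^(j+1) ≤ Y0 →
        (q:ℝ) ≤ Z * (2 * M + 1 : ℝ)^(j+2) * δ^(2^(j+1) * 2^(j+1)) →
        ∑ c ∈ Icc 1 Z, (W (c:ℕ))^(2^(j+1)) ≤
          C * T^(j+2) * Z * ((2 * M + 1 : ℝ) * δ^(2^(j+1)))^(2^(j+1)) ∧
        ∑ c ∈ Icc 1 Z, W (c:ℕ) ≤ C * T^(j+2) * Z * ((2 * M + 1 : ℝ) * δ^(2^(j+1))) := by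
  obtain ⟨C, hC, H⟩ := weyl_pack j
  refine ⟨C, hC, ?_⟩
  intro α a q N δ T Y0 ctx M hM hMD
  obtain ⟨W, hW0, hWe, hW00, hWb, hWs⟩ := H α a q ctx.hq ctx.hc ctx.hα T Y0 ctx.hT ctx.hd ctx.hTq M _ hM ctx.hqD hMD
  refine ⟨W, hW0, hWe, hW00, hWb, ?_⟩
  intro Z hZ hZY hqZ
  have h1 := hWs Z hZ hZY hqZ
  set K := 2^(j+1) with hK
  have hK0 : K ≠ 0 := by rw [hK]; positivity
  have h2 : ∑ c ∈ Icc 1 Z, (W (c:ℕ))^K ≤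
          C * T^(j+2) * Z * ((2 * M + 1 : ℝ) * δ^K)^K := by
    refine h1.trans (le_of_eq ?_)
    rw [mul_pow, ← pow_mul]; ring
  refine ⟨h2, ?_⟩
  have hT := ctx.hT
  have hδ := ctx.hδ0
  have hZ' : (0:ℝ) < Z := by exact_mod_cast hZ
  have h3 := pow_mean (Icc 1 Z) (fun c : ℕ => W (c:ℕ)) (fun i _ => hW0 _) K hK0
  rw [Nat.card_Icc, Nat.add_sub_cancel] at h3
  have hc : 1 ≤ C * T^(j+2) := one_le_mul_of_one_le_of_one_le hC (one_le_pow₀ hT)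
  have h4 : (∑ c ∈ Icc 1 Z, W (c:ℕ))^K ≤ C * T^(j+2) * (Z * ((2 * M + 1 : ℝ) * δ^K))^K := by
    have : (∑ c ∈ Icc 1 Z, W (c:ℕ))^K * Z ≤ C * T^(j+2) * (Z * ((2 * M + 1 : ℝ) * δ^K))^K * Z := by
      refine h3.trans ?_
      calc _ ≤ (Z:ℝ)^K * (C * T^(j+2) * Z * ((2 * M + 1 : ℝ) * δ^K)^K) := by
            exact mul_le_mul_of_nonneg_left h2 (by positivity)
        _ = _ := by rw [mul_pow (Z:ℝ)]; ring
    exact le_of_mul_le_mul_right this hZ'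
  have := root_le hK0 hc (by positivity) h4
  linarith

set_option maxHeartbeats 1000000 in
lemma typeII_block (j : ℕ) : ∃ (C : ℝ) (R : ℕ), 1 ≤ C ∧ ∀ (α : ℝ) (a : ℤ) (q N : ℕ) (δ T : ℝ) (Y0 : ℕ),
    Ctx j α a q N δ T Y0 → R * N^(j+2) ≤ Y0 → ∀ L : ℕ, 1 ≤ L → L * L ≤ N → 1 ≤ (2 * L : ℝ) * δ^(2^(j+1)) →
    ∀ (x : ℕ → ℂ) (b : ℤ → ℂ) (A B : ℝ), 0 ≤ A → 0 ≤ B → (∀ n, ‖x n‖ ≤ A) → (∀ n, ‖b n‖ ≤ B) →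
    (∀ n ∉ Icc (L:ℤ) (L+L), b n = 0) → ∀ φ : ℤ → ℕ,
    ‖∑ m ∈ Icc 1 (N / L), x m * ∑ n ∈ Icc (L:ℤ) (L+L), b n * (if m ≤ φ n then 1 else 0) *
      e (α * (m:ℝ)^(j+2) * ((n^(j+2) : ℤ) : ℝ))‖ ≤ C * T^(2*j+3) * (A * B * N * δ) := by
  obtain ⟨C1, hC1, H1⟩ := pack2 j
  obtain ⟨R0, hR0, H2⟩ := typeII_rec (j+1) 1 (by norm_num)
  set K := 2^(j+1) with hK
  have hK0 : K ≠ 0 := by rw [hK]; positivity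
  set C2 : ℝ := (1 + 2 * 2^(j+1) * (j+1) * R0) * 2 + 2 * 2^(j+1) * C1 * R0 * 3 with hC2
  have hR0' : (1:ℝ) ≤ R0 := by exact_mod_cast hR0
  refine ⟨3^K * C2, R0, ?_, ?_⟩
  · have h1 : (1:ℝ) ≤ 3^K := one_le_pow₀ (by norm_num)
    have h2 : (1:ℝ) ≤ C2 := by
      rw [hC2]
      have h0 : (0:ℝ) ≤ 2 * 2^(j+1) * (j+1) * R0 := by positivity
      have h0' : (0:ℝ) ≤ 2 * 2^(j+1) * C1 * R0 * 3 := by positivity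
      linarith
    exact one_le_mul_of_one_le_of_one_le h1 h2
  intro α a q N δ T Y0 ctx hY0 L hL hLN hLδ x b A B hA hB hx hb hbs φ
  have hT := ctx.hT
  have hδ := ctx.hδ0
  set M := N / L with hM
  have hLM : L ≤ M := by rw [hM, Nat.le_div_iff_mul_le hL]; exact hLN
  have hM1 : 1 ≤ M := hL.trans hLM
  have hML : M * L ≤ N := Nat.div_mul_le_self N L
  have hNM : N ≤ (2 * M + 1) * L := by
    have := Nat.lt_div_mul_add (a := N) hL
    rw [← hM] at this
    nlinarith
  have hNM' : (N:ℝ) ≤ (2 * M + 1) * L := by exact_mod_cast hNM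
  have hML' : (M:ℝ) * L ≤ N := by exact_mod_cast hML
  have hL' : (1:ℝ) ≤ L := by exact_mod_cast hL
  have hM' : (1:ℝ) ≤ M := by exact_mod_cast hM1
  have hLN' : (L:ℝ) * L ≤ N := by exact_mod_cast hLN
  set D := δ^(K * K) with hD
  have hD0 : 0 < D := by positivity
  set P : ℝ := 2 * M + 1 with hP
  have hP0 : 0 < P := by positivity
  have hP3 : P ≤ 3 * M := by rw [hP]; linarith
  have hN0 : (0:ℝ) < N := by exact_mod_cast ctx.hN
  have hPD : 1 ≤ P * D := by
    have h1 := ctx.hND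
    have h2 : (N:ℝ) ≤ P^2 := by
      have : (N:ℝ) * N ≤ P^2 * N := by
        calc (N:ℝ) * N ≤ (P * L) * (P * L) := by gcongr
          _ = P^2 * (L * L) := by ring
          _ ≤ _ := by gcongr
      exact le_of_mul_le_mul_right this hN0
    have h3 : 1 ≤ (P * D)^2 := by
      calc 1 ≤ (N:ℝ) * D^2 := h1
        _ ≤ P^2 * D^2 := by gcongr
        _ = _ := by ring
    by_contra h
    push Not at h
    have : (P*D)^2 < 1 := pow_lt_one₀ (by positivity) h (by norm_num)
    linarith
  obtain ⟨W, hW0, hWe, hW00, hWb, hWs⟩ := H1 α a q N δ T Y0 ctx M hM1 hPD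
  set f : ℕ → ℤ → ℂ := fun m n => b n * (if m ≤ φ n then 1 else 0) *
      e (α * (m:ℝ)^(j+2) * ((n^(j+2) : ℤ) : ℝ)) with hf
  set X : ℝ := 2 * L + 1 with hX
  have hX0 : 0 < X := by positivity
  -- step 1
  have s1 : ‖∑ m ∈ Icc 1 M, x m * ∑ n ∈ Icc (L:ℤ) (L+L), f m n‖ ≤
      A * ∑ m ∈ Icc 1 M, ‖∑ n ∈ Icc (L:ℤ) (L+L), f m n‖ := by
    refine (norm_sum_le _ _).trans ?_
    rw [mul_sum]
    refine sum_le_sum fun m _ => ?_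
    rw [norm_mul]
    gcongr
    exact hx m
  have s2 := pow_mean (Icc 1 M) (fun m => ‖∑ n ∈ Icc (L:ℤ) (L+L), f m n‖) (fun i _ => norm_nonneg _) K hK0
  rw [Nat.card_Icc, Nat.add_sub_cancel] at s2
  have s3 : ∀ m, ‖∑ n ∈ Icc (L:ℤ) (L+L), f m n‖^K * X^(j+2) ≤
      X^K * (GG (Icc (L:ℤ) (L+L)) (Icc (-(L:ℤ)) L) (j+1) (f m)).re := by
    intro m
    apply GG_ineq
    intro n hn
    simp only [hf, hbs n hn, zero_mul]
  have s4 : (∑ m ∈ Icc 1 M, ‖∑ n ∈ Icc (L:ℤ) (L+L), f m n‖^K) * X^(j+2) ≤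
      X^K * ‖∑ m ∈ Icc 1 M, GG (Icc (L:ℤ) (L+L)) (Icc (-(L:ℤ)) L) (j+1) (f m)‖ := by
    calc _ ≤ ∑ m ∈ Icc 1 M, X^K * (GG (Icc (L:ℤ) (L+L)) (Icc (-(L:ℤ)) L) (j+1) (f m)).re := by
          rw [sum_mul]; exact sum_le_sum fun m _ => s3 m
      _ = X^K * (∑ m ∈ Icc 1 M, GG (Icc (L:ℤ) (L+L)) (Icc (-(L:ℤ)) L) (j+1) (f m)).re := by
          rw [← mul_sum, Complex.re_sum]
      _ ≤ _ := by gcongr; exact Complex.re_le_norm _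
  have s5 := H2 L M (j+2) α W hW0 hWb b B hb φ 1 (fun i => if i = j+2 then 1 else 0) (by
      intro i hi
      split_ifs with h
      · subst h; simp
      · simp) (by simp)
  have hpoly : ∀ n : ℤ, (1:ℤ) * ∑ i ∈ range (j+1+2), (if i = j+2 then (1:ℤ) else 0) * n^i = n^(j+2) := by
    intro n
    rw [one_mul]
    simp [ite_mul]
  simp only [hpoly] at s5
  have s6 : SH (Icc (-(L:ℤ)) L) (j+1) (fun x => ∑ u ∈ Icc (-((R0:ℤ) * L)) (R0 * L), W (1 * x * u)) ≤
      C2 * T^(2*j+3) * X^(j+2) * M * δ^K := by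
    have hev : ∀ u : ℤ, SH (Icc (-(L:ℤ)) L) (j+1) (fun x => W (-u * x)) = SH (Icc (-(L:ℤ)) L) (j+1) (fun x => W (u * x)) := by
      intro u; congr 1; funext x; rw [neg_mul, hWe]
    have e1 : SH (Icc (-(L:ℤ)) L) (j+1) (fun x => ∑ u ∈ Icc (-((R0:ℤ) * L)) (R0 * L), W (1 * x * u)) =
        X^(j+1) * W 0 + 2 * ∑ u ∈ Icc 1 (R0 * L), SH (Icc (-(L:ℤ)) L) (j+1) (fun x => W (u * x)) := by
      rw [SH_sum]
      have := sum_sym (R0 * L) (fun u => SH (Icc (-(L:ℤ)) L) (j+1) (fun x => W (u * x))) hev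
      simp only [zero_mul, SH_const] at this
      push_cast at this
      have hcard : ((#(Icc (-(L:ℤ)) L) : ℕ) : ℝ) = X := by
        rw [Int.card_Icc, hX]
        have : ((L:ℤ) + 1 - (-(L:ℤ))).toNat = 2 * L + 1 := by omega
        rw [this]; push_cast; ring
      rw [hcard] at this
      rw [← this]
      refine sum_congr rfl fun u _ => ?_
      congr 1; funext x; rw [one_mul, mul_comm]
    rw [e1]
    have hZ : R0 * L * L^(j+1) ≤ R0 * N^(j+2) := by
      have h1 : L ≤ N := by nlinarith
      calc R0 * L * L^(j+1) = R0 * L^(j+2) := by ring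
        _ ≤ _ := by gcongr
    have c1 := count L hL T hT Y0 ctx.hd W hW0 hWe (j+1) (R0 * L) (hZ.trans hY0)
    have hZ2 : R0 * L * L^(j+1) * M^(j+1) ≤ R0 * N^(j+2) := by
      have h1 : L ≤ N := by nlinarith
      calc R0 * L * L^(j+1) * M^(j+1) = R0 * (M * L)^(j+1) * L := by ring
        _ ≤ R0 * N^(j+1) * N := by gcongr
        _ = _ := by ring
    have hZ3 : 1 ≤ R0 * L * L^(j+1) := Nat.mul_pos (Nat.mul_pos hR0 hL) (pow_pos hL _)
    have hZ4 : (q:ℝ) ≤ ((R0 * L * L^(j+1) : ℕ):ℝ) * P^(j+2) * D := by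
      push_cast
      calc (q:ℝ) ≤ (N:ℝ)^(j+2) * D := ctx.hqN
        _ ≤ (P * L)^(j+2) * D := by gcongr
        _ = 1 * (P * L)^(j+2) * D := by ring
        _ ≤ R0 * (P * L)^(j+2) * D := by gcongr
        _ = _ := by ring
    have c2 := (hWs _ hZ3 (hZ2.trans hY0) hZ4).2
    have hLX : (L:ℝ) ≤ X := by rw [hX]; linarith
    have h1X : 1 ≤ 2 * X * δ^K := by
      calc 1 ≤ 2 * L * δ^K := hLδ
        _ ≤ _ := by gcongr
    have c3 : ((j+1:ℕ):ℝ) * ((R0 * L : ℕ):ℝ) * X^(j+1) / X * W 0 ≤ (j+1) * R0 * X^(j+1) * M := by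
      calc _ = ((j+1) * R0 * X^j) * L * W 0 := by
            push_cast; field_simp; ring
        _ ≤ ((j+1) * R0 * X^j) * X * M := by
            have := hW0 0
            gcongr
        _ = _ := by ring
    have c4 : ∑ l ∈ Icc 1 (R0 * L * L^(j+1)), W (l:ℕ) ≤ C1 * T^(j+2) * (R0 * X^(j+2)) * (3 * M * δ^K) := by
      refine c2.trans ?_
      have : ((R0 * L * L^(j+1) : ℕ):ℝ) ≤ R0 * X^(j+2) := by
        push_cast
        calc (R0:ℝ) * L * L^(j+1) = R0 * L^(j+2) := by ring
          _ ≤ _ := by gcongr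
      gcongr
    calc X^(j+1) * W 0 + 2 * ∑ u ∈ Icc 1 (R0 * L), SH (Icc (-(L:ℤ)) L) (j+1) (fun x => W (u * x))
        ≤ X^(j+1) * M + 2 * ((2*T)^(j+1) * ((j+1) * R0 * X^(j+1) * M + C1 * T^(j+2) * (R0 * X^(j+2)) * (3 * M * δ^K))) := by
          refine add_le_add (by gcongr) (mul_le_mul_of_nonneg_left (c1.trans ?_) (by norm_num))
          exact mul_le_mul_of_nonneg_left (add_le_add c3 c4) (by positivity)
      _ = (1 + 2 * 2^(j+1) * (j+1) * R0 * T^(j+1)) * (X^(j+1) * M) * 1 + 2 * 2^(j+1) * C1 * R0 * 3 * T^(2*j+3) * X^(j+2) * M * δ^K := by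
          rw [mul_pow]; ring
      _ ≤ (1 * T^(2*j+3) + 2 * 2^(j+1) * (j+1) * R0 * T^(2*j+3)) * (X^(j+1) * M) * (2 * X * δ^K) + 2 * 2^(j+1) * C1 * R0 * 3 * T^(2*j+3) * X^(j+2) * M * δ^K := by
          have hTT : (1:ℝ) ≤ 1 * T^(2*j+3) := by rw [one_mul]; exact one_le_pow₀ hT
          have hTT2 : T^(j+1) ≤ T^(2*j+3) := pow_le_pow_right₀ hT (by omega)
          refine add_le_add_left ?_ _
          refine mul_le_mul ?_ h1X (by norm_num) (by positivity)
          refine mul_le_mul_of_nonneg_right ?_ (by positivity)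
          exact add_le_add hTT (mul_le_mul_of_nonneg_left hTT2 (by positivity))
      _ = _ := by rw [hC2]; ring
  have s7 : ‖∑ m ∈ Icc 1 M, GG (Icc (L:ℤ) (L+L)) (Icc (-(L:ℤ)) L) (j+1) (f m)‖ ≤
      B^K * (C2 * T^(2*j+3) * X^(j+2) * M * δ^K) := by
    refine s5.trans ?_
    gcongr
  have hC20 : 0 ≤ C2 := by rw [hC2]; positivity
  have s8 : (∑ m ∈ Icc 1 M, ‖∑ n ∈ Icc (L:ℤ) (L+L), f m n‖)^K ≤
      C2 * T^(2*j+3) * (B * (M * X) * δ)^K := by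
    have hpos : (0:ℝ) < X^(j+2) * M := by positivity
    refine le_of_mul_le_mul_right ?_ hpos
    calc (∑ m ∈ Icc 1 M, ‖∑ n ∈ Icc (L:ℤ) (L+L), f m n‖)^K * (X^(j+2) * M)
        = (∑ m ∈ Icc 1 M, ‖∑ n ∈ Icc (L:ℤ) (L+L), f m n‖)^K * M * X^(j+2) := by ring
      _ ≤ (M:ℝ)^K * (∑ m ∈ Icc 1 M, ‖∑ n ∈ Icc (L:ℤ) (L+L), f m n‖^K) * X^(j+2) := by gcongr
      _ = (M:ℝ)^K * ((∑ m ∈ Icc 1 M, ‖∑ n ∈ Icc (L:ℤ) (L+L), f m n‖^K) * X^(j+2)) := by ring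
      _ ≤ (M:ℝ)^K * (X^K * (B^K * (C2 * T^(2*j+3) * X^(j+2) * M * δ^K))) := by
          exact mul_le_mul_of_nonneg_left (s4.trans (mul_le_mul_of_nonneg_left s7 (by positivity))) (by positivity)
      _ = _ := by simp only [mul_pow]; ring
  have h3K : (3:ℝ) ≤ 3^K := le_self_pow₀ (by norm_num) hK0
  have hMX : M * X ≤ 3 * N := by
    rw [hX]
    calc (M:ℝ) * (2 * L + 1) ≤ M * (2 * L + L) := by gcongr
      _ = 3 * (M * L) := by ring
      _ ≤ _ := by gcongr
  have hC2T : 1 ≤ C2 * T^(2*j+3) := by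
    refine one_le_mul_of_one_le_of_one_le ?_ (one_le_pow₀ hT)
    rw [hC2]
    have h0 : (0:ℝ) ≤ 2 * 2^(j+1) * (j+1) * R0 := by positivity
    have h0' : (0:ℝ) ≤ 2 * 2^(j+1) * C1 * R0 * 3 := by positivity
    linarith
  have s9 := root_le hK0 hC2T (by positivity) s8
  calc _ ≤ A * ∑ m ∈ Icc 1 M, ‖∑ n ∈ Icc (L:ℤ) (L+L), f m n‖ := s1
    _ ≤ A * (C2 * T^(2*j+3) * (B * (M * X) * δ)) := by gcongr
    _ ≤ A * (C2 * T^(2*j+3) * (B * (3 * N) * δ)) := by gcongr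
    _ = 3 * (C2 * T^(2*j+3) * (A * B * N * δ)) := by ring
    _ ≤ 3^K * (C2 * T^(2*j+3) * (A * B * N * δ)) := by
        refine mul_le_mul_of_nonneg_right h3K ?_
        positivity
    _ = _ := by ring

end HarmanAux

namespace HarmanAux

lemma dyadic (N : ℕ) (F : ℕ → ℂ) (Bd : ℝ)
    (h : ∀ i, ‖∑ n ∈ (Icc 1 N).filter (fun n => Nat.log 2 n = i), F n‖ ≤ Bd) :
    ‖∑ n ∈ Icc 1 N, F n‖ ≤ ((Nat.log 2 N : ℝ) + 1) * Bd := by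
  have hm : ∀ n ∈ Icc 1 N, Nat.log 2 n ∈ range (Nat.log 2 N + 1) := by
    intro n hn
    rw [mem_Icc] at hn
    rw [mem_range]
    have := Nat.log_mono_right (b := 2) hn.2
    omega
  rw [← sum_fiberwise_of_maps_to hm]
  refine (norm_sum_le _ _).trans ?_
  refine (sum_le_card_nsmul _ _ Bd (fun i _ => h i)).trans ?_
  rw [card_range, nsmul_eq_mul]
  push_cast
  rfl

lemma mem_block {N n i : ℕ} (h : n ∈ (Icc 1 N).filter (fun n => Nat.log 2 n = i)) :
    1 ≤ n ∧ n ≤ N ∧ 2^i ≤ n ∧ n < 2 * 2^i := by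
  rw [mem_filter, mem_Icc] at h
  obtain ⟨⟨h1, h2⟩, rfl⟩ := h
  refine ⟨h1, h2, Nat.pow_log_le_self 2 (by omega), ?_⟩
  have := Nat.lt_pow_succ_log_self (b := 2) (by norm_num) n
  rw [pow_succ] at this
  omega

lemma sum_cast_Icc (L M : ℕ) (G : ℤ → ℂ) : ∑ z ∈ Icc (L:ℤ) M, G z = ∑ n ∈ Icc L M, G n := by
  symm
  refine sum_nbij (fun n : ℕ => (n:ℤ)) ?_ ?_ ?_ ?_
  · intro n hn; rw [mem_Icc] at *; omega
  · intro x _ y _ h; exact Int.ofNat.inj h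
  · intro z hz
    rw [coe_Icc, Set.mem_Icc] at hz
    refine ⟨z.toNat, ?_, ?_⟩
    · rw [coe_Icc, Set.mem_Icc]; omega
    · dsimp only; omega
  · intro n _; rfl

lemma typeII (j : ℕ) : ∃ (C : ℝ) (R : ℕ), 1 ≤ C ∧ ∀ (α : ℝ) (a : ℤ) (q N : ℕ) (δ T : ℝ) (Y0 : ℕ),
    Ctx j α a q N δ T Y0 → R * N^(j+2) ≤ Y0 → ∀ U : ℕ, 1 ≤ (U + 1 : ℝ) * δ^(2^(j+1)) →
    ∀ (x b : ℕ → ℂ) (A B : ℝ), 0 ≤ A → 0 ≤ B → (∀ n, 1 ≤ n → n ≤ N → ‖x n‖ ≤ A) → (∀ n, 1 ≤ n → n ≤ N → ‖b n‖ ≤ B) →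
    (∀ n, b n ≠ 0 → U < n ∧ n * n ≤ N) →
    ‖∑ n ∈ Icc 1 N, b n * ∑ m ∈ Icc 1 (N / n), x m * e (α * ((m * n : ℕ):ℝ)^(j+2))‖
      ≤ C * T^(2*j+4) * (A * B * N * δ) := by
  obtain ⟨C, R, hC, H⟩ := typeII_block j
  refine ⟨C, R, hC, ?_⟩
  intro α a q N δ T Y0 ctx hY0 U hU x b A B hA hB hx hb hbs
  have hT := ctx.hT
  have hδ := ctx.hδ0
  have key := dyadic N (fun n => b n * ∑ m ∈ Icc 1 (N / n), x m * e (α * ((m * n : ℕ):ℝ)^(j+2)))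
    (C * T^(2*j+3) * (A * B * N * δ)) ?_
  · refine key.trans ?_
    calc _ ≤ T * (C * T^(2*j+3) * (A * B * N * δ)) := by
          have := ctx.hTN
          gcongr
      _ = _ := by ring
  intro i
  by_cases hz : ∀ n ∈ (Icc 1 N).filter (fun n => Nat.log 2 n = i), b n = 0
  · rw [sum_eq_zero (fun n hn => by simp only [hz n hn, zero_mul]), norm_zero]
    positivity
  push Not at hz
  obtain ⟨n0, hn0, hbn0⟩ := hz
  obtain ⟨h1, h2, h3, h4⟩ := mem_block hn0
  obtain ⟨h5, h6⟩ := hbs n0 hbn0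
  set L := 2^i with hL
  have hL1 : 1 ≤ L := Nat.one_le_two_pow
  have hLL : L * L ≤ N := (Nat.mul_le_mul h3 h3).trans h6
  have hLδ : 1 ≤ (2 * L : ℝ) * δ^(2^(j+1)) := by
    refine hU.trans ?_
    have : (U + 1 : ℝ) ≤ 2 * L := by exact_mod_cast (by omega : U + 1 ≤ 2 * L)
    gcongr
  set b' : ℤ → ℂ := fun z => if z.toNat ∈ (Icc 1 N).filter (fun n => Nat.log 2 n = i) then b z.toNat else 0 with hb'
  have main := H α a q N δ T Y0 ctx hY0 L hL1 hLL hLδ (fun m => if 1 ≤ m ∧ m ≤ N then x m else 0) b' A B hA hB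
    (by intro n; split_ifs with h
        · exact hx n h.1 h.2
        · simpa using hA)
    (by intro n; simp only [hb']; split_ifs with h
        · exact hb _ (mem_block h).1 (mem_block h).2.1
        · simpa using hB)
    (by intro n hn; simp only [hb']; rw [if_neg]
        intro h
        have := mem_block h
        rw [← hL] at this
        apply hn; rw [mem_Icc]; omega)
    (fun z => N / z.toNat)
  convert main using 2
  simp_rw [mul_sum]
  rw [sum_comm]
  have hLL2 : ((L:ℤ) + L) = ((L + L : ℕ) : ℤ) := by push_cast; rfl
  rw [hLL2, sum_cast_Icc]
  have hsub : (Icc 1 N).filter (fun n => Nat.log 2 n = i) ⊆ Icc L (L+L) := by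
    intro n hn
    have := mem_block hn
    rw [← hL] at this
    rw [mem_Icc]; omega
  symm
  rw [← sum_subset hsub]
  · refine sum_congr rfl fun n hn => ?_
    have hmb := mem_block hn
    rw [← hL] at hmb
    have hbn : b' (n:ℕ) = b n := by simp only [hb', Int.toNat_natCast]; rw [if_pos hn]
    have hNn : N / n ≤ N / L := Nat.div_le_div_left hmb.2.2.1 hL1
    have hsub2 : Icc 1 (N / n) ⊆ Icc 1 (N / L) := Icc_subset_Icc_right hNn
    rw [← sum_subset hsub2]
    · refine sum_congr rfl fun m hm => ?_
      rw [mem_Icc] at hm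
      have hmN : m ≤ N := hm.2.trans (Nat.div_le_self _ _)
      rw [hbn, if_pos ⟨hm.1, hmN⟩, Int.toNat_natCast, if_pos hm.2]
      have : α * ((m * n : ℕ):ℝ)^(j+2) = α * (m:ℝ)^(j+2) * ((((n:ℕ):ℤ)^(j+2) : ℤ) : ℝ) := by
        push_cast; rw [mul_pow]; ring
      rw [this]; ring
    · intro m hm hm2
      rw [Int.toNat_natCast, if_neg (c := m ≤ N / n)]
      · simp
      · rw [mem_Icc] at *
        intro h
        exact hm2 ⟨hm.1, h⟩
  · intro n _ hn
    refine sum_eq_zero fun m _ => ?_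
    have hbn : b' (n:ℕ) = 0 := by simp only [hb', Int.toNat_natCast]; rw [if_neg hn]
    rw [hbn]; simp

end HarmanAux

namespace HarmanAux

def Good (N : ℕ) (E : ℝ) (x : ℕ → ℂ) : Prop :=
  ∀ (g : ℕ → ℂ) (w : ℝ) (X : ℕ), X ≤ N → (∀ Y ≤ X, ‖∑ m ∈ Icc 1 Y, g m‖ ≤ w) →
    ‖∑ m ∈ Icc 1 X, x m * g m‖ ≤ E * w

lemma good_one (N : ℕ) : Good N 1 (fun _ => 1) := by
  intro g w X _ h
  simp only [one_mul]
  exact h X le_rfl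

lemma abel (l : ℕ → ℝ) (g : ℕ → ℂ) (X : ℕ) :
    ∑ m ∈ Icc 1 X, (l m : ℂ) * g m = (l X : ℂ) * ∑ m ∈ Icc 1 X, g m -
      ∑ i ∈ range X, ((l (i+1) - l i : ℝ) : ℂ) * ∑ m ∈ Icc 1 i, g m := by
  induction X with
  | zero => simp
  | succ n ih =>
    rw [sum_Icc_succ_top (by omega), sum_range_succ, ih, sum_Icc_succ_top (by omega)]
    push_cast
    ring

lemma good_log (N : ℕ) : Good N (2 * Real.log N) (fun m => ((Real.log m : ℝ) : ℂ)) := by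
  intro g w X hX h
  have hw : 0 ≤ w := (norm_nonneg _).trans (h 0 (by omega))
  rw [abel (fun m => Real.log m)]
  have hmono : ∀ i : ℕ, 0 ≤ Real.log ((i+1 : ℕ):ℝ) - Real.log (i:ℝ) := by
    intro i
    rcases Nat.eq_zero_or_pos i with rfl | hi
    · simp
    · rw [sub_nonneg]
      apply Real.log_le_log
      · exact_mod_cast hi
      · push_cast; linarith
  have hlX : 0 ≤ Real.log X := Real.log_natCast_nonneg X
  have hXN : Real.log X ≤ Real.log N := by
    rcases Nat.eq_zero_or_pos X with rfl | hX0
    · simpa using Real.log_natCast_nonneg N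
    · apply Real.log_le_log
      · exact_mod_cast hX0
      · exact_mod_cast hX
  calc _ ≤ Real.log X * w + ∑ i ∈ range X, (Real.log ((i+1 : ℕ):ℝ) - Real.log (i:ℝ)) * w := by
        refine (norm_sub_le _ _).trans (add_le_add ?_ ?_)
        · rw [norm_mul, Complex.norm_real, Real.norm_of_nonneg hlX]
          gcongr
          exact h X le_rfl
        · refine (norm_sum_le _ _).trans (sum_le_sum fun i hi => ?_)
          rw [norm_mul, Complex.norm_real, Real.norm_of_nonneg (hmono i)]
          exact mul_le_mul_of_nonneg_left (h i (mem_range.1 hi).le) (hmono i)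
    _ = 2 * Real.log X * w := by
        rw [← sum_mul, sum_range_sub (fun i : ℕ => Real.log (i:ℝ))]
        simp; ring
    _ ≤ _ := by gcongr

set_option maxHeartbeats 1000000 in
lemma typeI (j : ℕ) : ∃ (C : ℝ) (R : ℕ), 1 ≤ C ∧ ∀ (α : ℝ) (a : ℤ) (q N : ℕ) (δ T : ℝ) (Y0 : ℕ),
    Ctx j α a q N δ T Y0 → R * N^(j+2) ≤ Y0 → ∀ U : ℕ, (U : ℝ) * δ^(2^(j+1)) ≤ 1 →
    ∀ (x b : ℕ → ℂ) (E B : ℝ), 0 ≤ E → 0 ≤ B → Good N E x → (∀ n, 1 ≤ n → n ≤ N → ‖b n‖ ≤ B) →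
    (∀ n, b n ≠ 0 → n ≤ U) →
    ‖∑ n ∈ Icc 1 N, b n * ∑ m ∈ Icc 1 (N / n), x m * e (α * ((m * n : ℕ):ℝ)^(j+2))‖
      ≤ C * T^(j+3) * (E * B * N * δ) := by
  obtain ⟨C, hC, H⟩ := pack2 j
  refine ⟨C * 2^(j+2) * 3, 2^(j+2), ?_, ?_⟩
  · refine one_le_mul_of_one_le_of_one_le (one_le_mul_of_one_le_of_one_le hC (one_le_pow₀ (by norm_num))) (by norm_num)
  intro α a q N δ T Y0 ctx hY0 U hU x b E B hE hB hx hb hbs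
  have hT := ctx.hT
  have hδ := ctx.hδ0
  have hδ1 := ctx.hδ1
  have key := dyadic N (fun n => b n * ∑ m ∈ Icc 1 (N / n), x m * e (α * ((m * n : ℕ):ℝ)^(j+2)))
    (C * 2^(j+2) * 3 * T^(j+2) * (E * B * N * δ)) ?_
  · refine key.trans ?_
    calc _ ≤ T * (C * 2^(j+2) * 3 * T^(j+2) * (E * B * N * δ)) := by
          have := ctx.hTN
          gcongr
      _ = _ := by ring
  intro i
  by_cases hz : ∀ n ∈ (Icc 1 N).filter (fun n => Nat.log 2 n = i), b n = 0
  · rw [sum_eq_zero (fun n hn => by simp only [hz n hn, zero_mul]), norm_zero]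
    positivity
  push Not at hz
  obtain ⟨n0, hn0, hbn0⟩ := hz
  obtain ⟨h1, h2, h3, h4⟩ := mem_block hn0
  have h5 := hbs n0 hbn0
  have hblk : ∀ n ∈ (Icc 1 N).filter (fun n => Nat.log 2 n = i), _ := fun n hn => mem_block hn
  set s := (Icc 1 N).filter (fun n => Nat.log 2 n = i) with hs
  generalize hL : 2^i = L at *
  have hL1 : 1 ≤ L := by rw [← hL]; exact Nat.one_le_two_pow
  have hLN : L ≤ N := h3.trans h2
  set M := N / L with hM
  have hM1 : 1 ≤ M := by rw [hM, Nat.le_div_iff_mul_le hL1]; omega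
  have hML : M * L ≤ N := Nat.div_mul_le_self N L
  have hNM : N ≤ (2 * M + 1) * L := by
    have := Nat.lt_div_mul_add (a := N) hL1
    rw [← hM] at this
    nlinarith
  have hNM' : (N:ℝ) ≤ (2 * M + 1) * L := by exact_mod_cast hNM
  have hML' : (M:ℝ) * L ≤ N := by exact_mod_cast hML
  have hL' : (1:ℝ) ≤ L := by exact_mod_cast hL1
  have hLN' : (L:ℝ) ≤ N := by exact_mod_cast hLN
  have hK0 : 2^(j+1) ≠ 0 := by positivity
  have hKj : j + 2 ≤ 2^(j+1) := Nat.lt_two_pow_self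
  have hKK : 2^(j+1) ≤ 2^(j+1) * 2^(j+1) := Nat.le_mul_self _
  have hH := H α a q N δ T Y0 ctx M hM1
  have hND := ctx.hND
  have hqN := ctx.hqN
  generalize hK : 2^(j+1) = K at *
  set D := δ^(K * K) with hD
  have hD0 : 0 < D := by positivity
  set P : ℝ := 2 * M + 1 with hP
  have hP0 : 0 < P := by positivity
  have hN0 : (0:ℝ) < N := by exact_mod_cast ctx.hN
  have hLδ : L * δ^K ≤ 1 := by
    refine le_trans ?_ hU
    have : (L:ℝ) ≤ U := by exact_mod_cast h3.trans h5
    gcongr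
  have hPD : 1 ≤ P * D := by
    have hDδ : D ≤ δ^K := pow_le_pow_of_le_one hδ.le hδ1 hKK
    have h6 : L * D ≤ 1 := by
      refine le_trans ?_ hLδ
      gcongr
    have h7 : L * D ≤ (N * D) * D := by
      calc L * D ≤ 1 := h6
        _ ≤ N * D^2 := hND
        _ = _ := by ring
    have h8 : (L:ℝ) ≤ N * D := le_of_mul_le_mul_right h7 hD0
    have h9 : 1 * (L:ℝ) ≤ P * D * L := by
      calc 1 * (L:ℝ) ≤ N * D := by rw [one_mul]; exact h8
        _ ≤ (P * L) * D := by gcongr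
        _ = _ := by ring
    exact le_of_mul_le_mul_right h9 (by linarith)
  obtain ⟨W, hW0, hWe, hW00, hWb, hWs⟩ := hH hPD
  -- bound each term
  have t1 : ∀ n ∈ s, ‖b n * ∑ m ∈ Icc 1 (N / n), x m * e (α * ((m * n : ℕ):ℝ)^(j+2))‖ ≤
      B * (E * W ((n^(j+2) : ℕ) : ℤ)) := by
    intro n hn
    have hmb := hblk n hn
    rw [norm_mul]
    have : ‖∑ m ∈ Icc 1 (N / n), x m * e (α * ((m * n : ℕ):ℝ)^(j+2))‖ ≤ E * W ((n^(j+2) : ℕ) : ℤ) := by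
      apply hx _ _ _ (Nat.div_le_self _ _)
      intro Y hY
      have hYM : Y ≤ M := hY.trans (Nat.div_le_div_left hmb.2.2.1 hL1)
      refine le_trans (le_of_eq ?_) (hWb _ Y hYM)
      congr 1
      refine sum_congr rfl fun m _ => ?_
      congr 1
      push_cast
      rw [mul_pow]; ring
    have h0 := hW0 ((n^(j+2) : ℕ) : ℤ)
    have hbn := hb n hmb.1 hmb.2.1
    gcongr
  have t2 : ‖∑ n ∈ s, b n * ∑ m ∈ Icc 1 (N / n), x m * e (α * ((m * n : ℕ):ℝ)^(j+2))‖ ≤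
      B * E * ∑ n ∈ s, W ((n^(j+2) : ℕ) : ℤ) := by
    refine (norm_sum_le _ _).trans ((sum_le_sum t1).trans (le_of_eq ?_))
    rw [mul_sum]
    exact sum_congr rfl fun n _ => by ring
  have hcard : #s ≤ L := by
    calc #s ≤ #(Ico L (2 * L)) := card_le_card (by
          intro n hn
          have := hblk n hn
          rw [mem_Ico]; omega)
      _ = L := by rw [Nat.card_Ico]; omega
  have t3 : (∑ n ∈ s, W ((n^(j+2) : ℕ) : ℤ))^K * L ≤ (L:ℝ)^K * ∑ n ∈ s, (W ((n^(j+2) : ℕ) : ℤ))^K := by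
    obtain ⟨r, rfl⟩ := Nat.exists_eq_succ_of_ne_zero hK0
    have h6 := pow_sum_le_card_mul_sum_pow (s := s) (f := fun n : ℕ => W ((n^(j+2) : ℕ) : ℤ)) (fun i _ => hW0 _) r
    have h7 : (#s : ℝ)^r ≤ (L:ℝ)^r := by
      have : (#s : ℝ) ≤ L := by exact_mod_cast hcard
      gcongr
    have h8 : 0 ≤ ∑ n ∈ s, (W ((n^(j+2) : ℕ) : ℤ))^(r+1) := sum_nonneg fun n _ => pow_nonneg (hW0 _) _
    calc _ ≤ ((L:ℝ)^r * ∑ n ∈ s, (W ((n^(j+2) : ℕ) : ℤ))^(r+1)) * L := by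
          refine mul_le_mul_of_nonneg_right (h6.trans (mul_le_mul_of_nonneg_right h7 h8)) (by positivity)
      _ = _ := by rw [Nat.succ_eq_add_one]; ring
  have t4 : ∑ n ∈ s, (W ((n^(j+2) : ℕ) : ℤ))^K ≤ ∑ c ∈ Icc 1 ((2 * L)^(j+2)), (W (c:ℕ))^K := by
    have hinj : Set.InjOn (fun n : ℕ => n^(j+2)) s := by
      intro x _ y _ h
      exact Nat.pow_left_injective (by omega) h
    have himg := sum_image (f := fun c : ℕ => (W (c:ℕ))^K) hinj
    rw [← himg]
    apply sum_le_sum_of_subset_of_nonneg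
    · intro l hl
      obtain ⟨n, hn, rfl⟩ := mem_image.1 hl
      have := hblk n hn
      rw [mem_Icc]
      exact ⟨Nat.one_le_pow _ _ this.1, Nat.pow_le_pow_left this.2.2.2.le _⟩
    · intro l _ _; exact pow_nonneg (hW0 _) _
  have hZY : (2 * L)^(j+2) * M^(j+1) ≤ Y0 := by
    refine le_trans ?_ hY0
    calc (2 * L)^(j+2) * M^(j+1) = 2^(j+2) * ((M * L)^(j+1) * L) := by rw [mul_pow, mul_pow]; ring
      _ ≤ 2^(j+2) * (N^(j+1) * N) := by gcongr
      _ = _ := by ring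
  have hqZ : (q:ℝ) ≤ (((2 * L)^(j+2) : ℕ):ℝ) * P^(j+2) * D := by
    push_cast
    calc (q:ℝ) ≤ (N:ℝ)^(j+2) * D := hqN
      _ ≤ (P * L)^(j+2) * D := by gcongr
      _ = 1 * (P * L)^(j+2) * D := by ring
      _ ≤ 2^(j+2) * (P * L)^(j+2) * D := by
        have : (1:ℝ) ≤ 2^(j+2) := one_le_pow₀ (by norm_num)
        gcongr
      _ = _ := by rw [mul_pow, mul_pow]; ring
  have t5 := (hWs _ (Nat.one_le_pow _ _ (by omega)) hZY hqZ).1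
  have t6 : (L:ℝ)^(j+1) * δ^(K*K) ≤ δ^K := by
    have h6 : K * K = K * (j+1) + (K * (K - (j+2)) + K) := by
      obtain ⟨d, rfl⟩ := Nat.exists_eq_add_of_le hKj
      rw [Nat.add_sub_cancel_left]; ring
    rw [h6, pow_add δ, pow_mul δ K (j+1), ← mul_assoc, ← mul_pow]
    have h7 : (L * δ^K)^(j+1) ≤ 1 := pow_le_one₀ (by positivity) hLδ
    have h8 : δ^(K * (K - (j+2)) + K) ≤ δ^K := pow_le_pow_of_le_one hδ.le hδ1 (by omega)
    calc (L * δ^K)^(j+1) * δ^(K * (K - (j+2)) + K) ≤ 1 * δ^K := by gcongr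
      _ = _ := one_mul _
  have hLP : L * P ≤ 3 * N := by
    rw [hP]; nlinarith
  have t7 : (∑ n ∈ s, W ((n^(j+2) : ℕ) : ℤ))^K ≤ (C * 2^(j+2) * T^(j+2)) * (3 * N * δ)^K := by
    have hLpos : (0:ℝ) < L := by linarith
    refine le_of_mul_le_mul_right ?_ hLpos
    calc _ ≤ (L:ℝ)^K * (C * T^(j+2) * (((2 * L)^(j+2) : ℕ):ℝ) * (P * δ^K)^K) := by
          refine t3.trans (mul_le_mul_of_nonneg_left (t4.trans t5) (by positivity))
      _ = (C * 2^(j+2) * T^(j+2)) * ((L * P)^K * ((L:ℝ)^(j+1) * δ^(K*K))) * L := by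
          push_cast
          rw [mul_pow (2:ℝ), mul_pow (L:ℝ) P, mul_pow P, ← pow_mul]; ring
      _ ≤ (C * 2^(j+2) * T^(j+2)) * ((3 * N)^K * δ^K) * L := by gcongr
      _ = _ := by rw [mul_pow (3 * (N:ℝ))]
  have hc1 : 1 ≤ C * 2^(j+2) * T^(j+2) :=
    one_le_mul_of_one_le_of_one_le (one_le_mul_of_one_le_of_one_le hC (one_le_pow₀ (by norm_num))) (one_le_pow₀ hT)
  have t8 := root_le hK0 hc1 (by positivity) t7
  calc _ ≤ B * E * ∑ n ∈ s, W ((n^(j+2) : ℕ) : ℤ) := t2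
    _ ≤ B * E * (C * 2^(j+2) * T^(j+2) * (3 * N * δ)) := by gcongr
    _ = _ := by ring

end HarmanAux

namespace HarmanAux

open ArithmeticFunction in
noncomputable def res (p : ℕ → Prop) (f : ArithmeticFunction ℝ) : ArithmeticFunction ℝ :=
  ⟨fun n => if p n then f n else 0, by simp⟩

lemma res_apply (p : ℕ → Prop) (f : ArithmeticFunction ℝ) (n : ℕ) :
    res p f n = if p n then f n else 0 := rfl

lemma res_add (p : ℕ → Prop) (f : ArithmeticFunction ℝ) :
    res p f + res (fun n => ¬ p n) f = f := by
  ext n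
  rw [ArithmeticFunction.add_apply, res_apply, res_apply]
  by_cases h : p n <;> simp [h]

lemma abs_res_le (p : ℕ → Prop) (f : ArithmeticFunction ℝ) (n : ℕ) : |res p f n| ≤ |f n| := by
  rw [res_apply]; split_ifs
  · exact le_rfl
  · simp

lemma bil (f g : ArithmeticFunction ℝ) (F : ℕ → ℂ) (N : ℕ) :
    ∑ n ∈ Icc 1 N, (((f * g) n : ℝ) : ℂ) * F n =
      ∑ n ∈ Icc 1 N, (f n : ℂ) * ∑ m ∈ Icc 1 (N / n), (g m : ℂ) * F (m * n) := by
  have h1 : ∀ n ∈ Icc 1 N, (((f * g) n : ℝ) : ℂ) * F n =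
      ∑ x ∈ Icc 1 N ×ˢ Icc 1 N with x.1 * x.2 = n, (f x.1 : ℂ) * ((g x.2 : ℂ) * F (x.2 * x.1)) := by
    intro n hn
    rw [mem_Icc] at hn
    have hIcc : Icc 1 N = Ioc 0 N := rfl
    rw [ArithmeticFunction.mul_apply, Nat.divisorsAntidiagonal_eq_prod_filter_of_le (by omega) hn.2, hIcc]
    push_cast
    rw [sum_mul]
    refine sum_congr rfl fun x hx => ?_
    rw [mem_filter] at hx
    rw [mul_comm x.2, hx.2]; ring
  rw [sum_congr rfl h1]
  simp_rw [sum_filter]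
  rw [sum_comm, sum_product]
  refine sum_congr rfl fun n hn => ?_
  rw [mem_Icc] at hn
  rw [mul_sum]
  symm
  have hsub : Icc 1 (N / n) ⊆ Icc 1 N := Icc_subset_Icc_right (Nat.div_le_self _ _)
  rw [← sum_subset hsub]
  · refine sum_congr rfl fun m hm => ?_
    rw [mem_Icc] at hm
    have hnm : n * m ≤ N := by
      rw [mul_comm]; exact (Nat.le_div_iff_mul_le hn.1).1 hm.2
    rw [sum_ite_eq, if_pos]
    rw [mem_Icc]; exact ⟨Nat.mul_pos hn.1 hm.1, hnm⟩
  · intro m hm hm2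
    rw [sum_ite_eq, if_neg]
    rw [mem_Icc] at *
    intro h
    exact hm2 ⟨hm.1, (Nat.le_div_iff_mul_le hn.1).2 (by rw [mul_comm]; exact h.2)⟩

noncomputable def mu : ArithmeticFunction ℝ := ((ArithmeticFunction.moebius : ArithmeticFunction ℤ) : ArithmeticFunction ℝ)
noncomputable def ze : ArithmeticFunction ℝ := ((ArithmeticFunction.zeta : ArithmeticFunction ℕ) : ArithmeticFunction ℝ)

lemma abs_mu_le (n : ℕ) : |mu n| ≤ 1 := by
  have := ArithmeticFunction.abs_moebius_le_one (n := n)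
  rw [mu, ArithmeticFunction.intCoe_apply]
  exact_mod_cast this

lemma vaughan (U : ℕ) :
    ArithmeticFunction.vonMangoldt = res (fun n => n ≤ U) ArithmeticFunction.vonMangoldt
      + res (fun n => n ≤ U) mu * ArithmeticFunction.log
      - (res (fun n => n ≤ U) ArithmeticFunction.vonMangoldt * res (fun n => n ≤ U) mu) * ze
      + res (fun n => ¬ n ≤ U) ArithmeticFunction.vonMangoldt * (res (fun n => ¬ n ≤ U) mu * ze) := by
  have h1 := res_add (fun n => n ≤ U) ArithmeticFunction.vonMangoldt
  have h2 := res_add (fun n => n ≤ U) mu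
  have h3 : ArithmeticFunction.vonMangoldt * ze = ArithmeticFunction.log := ArithmeticFunction.vonMangoldt_mul_zeta
  have h4 : mu * ze = 1 := ArithmeticFunction.coe_moebius_mul_coe_zeta
  rw [← h1] at h3
  rw [← h2] at h4
  generalize res (fun n => n ≤ U) ArithmeticFunction.vonMangoldt = a at *
  generalize res (fun n => ¬ n ≤ U) ArithmeticFunction.vonMangoldt = b at *
  generalize res (fun n => n ≤ U) mu = c at *
  generalize res (fun n => ¬ n ≤ U) mu = d at *
  rw [← h1]
  linear_combination (-b) * h4 + c * h3

lemma vm_le {n N : ℕ} (h1 : 1 ≤ n) (h2 : n ≤ N) : |ArithmeticFunction.vonMangoldt n| ≤ Real.log N := by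
  rw [abs_of_nonneg ArithmeticFunction.vonMangoldt_nonneg]
  refine ArithmeticFunction.vonMangoldt_le_log.trans ?_
  apply Real.log_le_log
  · exact_mod_cast h1
  · exact_mod_cast h2

lemma cc_le (U : ℕ) {n N : ℕ} (h1 : 1 ≤ n) (h2 : n ≤ N) :
    |(res (fun n => n ≤ U) ArithmeticFunction.vonMangoldt * res (fun n => n ≤ U) mu) n| ≤ Real.log N := by
  rw [ArithmeticFunction.mul_apply]
  calc _ ≤ ∑ x ∈ n.divisorsAntidiagonal, ArithmeticFunction.vonMangoldt x.1 := by
        refine (abs_sum_le_sum_abs _ _).trans (sum_le_sum fun x _ => ?_)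
        rw [abs_mul]
        have i1 := (abs_res_le (fun n => n ≤ U) ArithmeticFunction.vonMangoldt x.1)
        rw [abs_of_nonneg (a := ArithmeticFunction.vonMangoldt x.1) ArithmeticFunction.vonMangoldt_nonneg] at i1
        have i2 := (abs_res_le (fun n => n ≤ U) mu x.2).trans (abs_mu_le _)
        calc _ ≤ ArithmeticFunction.vonMangoldt x.1 * 1 :=
              mul_le_mul i1 i2 (abs_nonneg _) ArithmeticFunction.vonMangoldt_nonneg
          _ = _ := mul_one _
    _ = ∑ i ∈ n.divisors, ArithmeticFunction.vonMangoldt i :=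
        Nat.sum_divisorsAntidiagonal (fun i _ => ArithmeticFunction.vonMangoldt i)
    _ = Real.log n := ArithmeticFunction.vonMangoldt_sum
    _ ≤ _ := by
      apply Real.log_le_log
      · exact_mod_cast h1
      · exact_mod_cast h2

lemma cc_supp (U : ℕ) {n : ℕ} (h : (res (fun n => n ≤ U) ArithmeticFunction.vonMangoldt * res (fun n => n ≤ U) mu) n ≠ 0) :
    n ≤ U * U := by
  by_contra hn
  apply h
  rw [ArithmeticFunction.mul_apply]
  refine sum_eq_zero fun x hx => ?_
  rw [Nat.mem_divisorsAntidiagonal] at hx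
  rw [res_apply, res_apply]
  split_ifs with h1 h2
  · exact absurd (hx.1 ▸ Nat.mul_le_mul h1 h2) hn
  all_goals simp

lemma dn_le (U n : ℕ) : |(res (fun n => ¬ n ≤ U) mu * ze) n| ≤ #(Nat.divisors n) := by
  rw [ArithmeticFunction.mul_apply]
  refine (abs_sum_le_sum_abs _ _).trans ?_
  have : ∀ x ∈ n.divisorsAntidiagonal, |res (fun n => ¬ n ≤ U) mu x.1 * ze x.2| ≤ 1 := by
    intro x _
    rw [abs_mul]
    have i1 := (abs_res_le (fun n => ¬ n ≤ U) mu x.1).trans (abs_mu_le _)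
    have i2 : |ze x.2| ≤ 1 := by
      rw [ze, ArithmeticFunction.natCoe_apply, ArithmeticFunction.zeta_apply]
      split_ifs <;> simp
    exact mul_le_one₀ i1 (abs_nonneg _) i2
  refine (sum_le_card_nsmul _ _ 1 this).trans ?_
  rw [← Nat.map_div_right_divisors, card_map]
  simp

lemma dn_supp (U n : ℕ) (h : (res (fun n => ¬ n ≤ U) mu * ze) n ≠ 0) : U < n := by
  by_contra hn
  apply h
  rw [ArithmeticFunction.mul_apply]
  refine sum_eq_zero fun x hx => ?_
  rw [Nat.mem_divisorsAntidiagonal] at hx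
  rw [res_apply, if_neg, zero_mul]
  rw [not_not]
  have := Nat.le_of_dvd (Nat.pos_of_ne_zero hx.2) (Dvd.intro _ hx.1)
  omega

end HarmanAux

namespace HarmanAux

lemma res_ne {p : ℕ → Prop} {f : ArithmeticFunction ℝ} {n : ℕ} (h : res p f n ≠ 0) : p n ∧ f n ≠ 0 := by
  rw [res_apply] at h
  by_cases hp : p n
  · rw [if_pos hp] at h; exact ⟨hp, h⟩
  · rw [if_neg hp] at h; exact absurd rfl h

lemma typeII' (j : ℕ) : ∃ (C : ℝ) (R : ℕ), 1 ≤ C ∧ ∀ (α : ℝ) (a : ℤ) (q N : ℕ) (δ T : ℝ) (Y0 : ℕ),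
    Ctx j α a q N δ T Y0 → R * N^(j+2) ≤ Y0 → ∀ U : ℕ, 1 ≤ (U + 1 : ℝ) * δ^(2^(j+1)) →
    ∀ (f g : ArithmeticFunction ℝ) (A B : ℝ), 0 ≤ A → 0 ≤ B → (∀ n, 1 ≤ n → n ≤ N → |g n| ≤ A) →
    (∀ n, 1 ≤ n → n ≤ N → |f n| ≤ B) →
    (∀ n, f n ≠ 0 → U < n ∧ n * n ≤ N) →
    ‖∑ n ∈ Icc 1 N, (((f * g) n : ℝ):ℂ) * e (α * (n:ℝ)^(j+2))‖
      ≤ C * T^(2*j+4) * (A * B * N * δ) := by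
  obtain ⟨C, R, hC, H⟩ := typeII j
  refine ⟨C, R, hC, ?_⟩
  intro α a q N δ T Y0 ctx hY0 U hU f g A B hA hB hg hf hs
  rw [bil f g (fun n => e (α * (n:ℝ)^(j+2)))]
  refine H α a q N δ T Y0 ctx hY0 U hU (fun n => (g n:ℂ)) (fun n => (f n : ℂ)) A B hA hB ?_ ?_ ?_
  · intro n h1 h2; rw [Complex.norm_real, Real.norm_eq_abs]; exact hg n h1 h2
  · intro n h1 h2; rw [Complex.norm_real, Real.norm_eq_abs]; exact hf n h1 h2
  · intro n hn; exact hs n (by exact_mod_cast hn)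

lemma typeI' (j : ℕ) : ∃ (C : ℝ) (R : ℕ), 1 ≤ C ∧ ∀ (α : ℝ) (a : ℤ) (q N : ℕ) (δ T : ℝ) (Y0 : ℕ),
    Ctx j α a q N δ T Y0 → R * N^(j+2) ≤ Y0 → ∀ U : ℕ, (U : ℝ) * δ^(2^(j+1)) ≤ 1 →
    ∀ (f g : ArithmeticFunction ℝ) (E B : ℝ), 0 ≤ E → 0 ≤ B → Good N E (fun n => (g n:ℂ)) →
    (∀ n, 1 ≤ n → n ≤ N → |f n| ≤ B) → (∀ n, f n ≠ 0 → n ≤ U) →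
    ‖∑ n ∈ Icc 1 N, (((f * g) n : ℝ):ℂ) * e (α * (n:ℝ)^(j+2))‖
      ≤ C * T^(j+3) * (E * B * N * δ) := by
  obtain ⟨C, R, hC, H⟩ := typeI j
  refine ⟨C, R, hC, ?_⟩
  intro α a q N δ T Y0 ctx hY0 U hU f g A B hA hB hg hf hs
  rw [bil f g (fun n => e (α * (n:ℝ)^(j+2)))]
  refine H α a q N δ T Y0 ctx hY0 U hU (fun n => (g n:ℂ)) (fun n => (f n : ℂ)) A B hA hB hg ?_ ?_
  · intro n h1 h2; rw [Complex.norm_real, Real.norm_eq_abs]; exact hf n h1 h2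
  · intro n hn; exact hs n (by exact_mod_cast hn)

lemma good_ze (N : ℕ) : Good N 1 (fun n => (ze n : ℂ)) := by
  intro g w X hX h
  have := good_one N g w X hX h
  refine le_trans (le_of_eq ?_) this
  congr 1
  refine sum_congr rfl fun m hm => ?_
  rw [mem_Icc] at hm
  dsimp only
  rw [ze, ArithmeticFunction.natCoe_apply, ArithmeticFunction.zeta_apply, if_neg (by omega)]
  simp

lemma good_log' (N : ℕ) : Good N (2 * Real.log N) (fun n => (ArithmeticFunction.log n : ℂ)) := by
  have := good_log N
  simpa only [ArithmeticFunction.log_apply] using this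

set_option maxHeartbeats 1000000 in
lemma mangoldt_bound (j : ℕ) : ∃ (C : ℝ) (R : ℕ), 1 ≤ C ∧ ∀ (α : ℝ) (a : ℤ) (q N : ℕ) (δ T : ℝ) (Y0 : ℕ),
    Ctx j α a q N δ T Y0 → R * N^(j+2) ≤ Y0 →
    ‖∑ n ∈ Icc 1 N, ((ArithmeticFunction.vonMangoldt n : ℝ):ℂ) * e (α * (n:ℝ)^(j+2))‖
      ≤ C * T^(2*j+6) * (N * δ) := by
  obtain ⟨C1, R1, hC1, H1⟩ := typeI' j
  obtain ⟨C2, R2, hC2, H2⟩ := typeII' j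
  refine ⟨1 + 3 * C1 + 3 * C2, R1 + R2 + 1, by linarith, ?_⟩
  intro α a q N δ T Y0 ctx hY0
  have hT := ctx.hT
  have hδ := ctx.hδ0
  have hδ1 := ctx.hδ1
  have hN := ctx.hN
  have hY1 : R1 * N^(j+2) ≤ Y0 := le_trans (Nat.mul_le_mul_right _ (by omega)) hY0
  have hY2 : R2 * N^(j+2) ≤ Y0 := le_trans (Nat.mul_le_mul_right _ (by omega)) hY0
  have hYN : N ≤ Y0 := by
    refine le_trans ?_ hY0
    calc N = 1 * N^1 := by ring
      _ ≤ (R1 + R2 + 1) * N^(j+2) := by gcongr <;> omega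
  have hH1 := H1 α a q N δ T Y0 ctx hY1
  have hH2 := H2 α a q N δ T Y0 ctx hY2
  have hND := ctx.hND
  have hK2 : 2 ≤ 2^(j+1) := by rw [pow_succ]; have := Nat.one_le_two_pow (n := j); omega
  generalize hK : 2^(j+1) = K at *
  set U := ⌊(δ^K)⁻¹⌋₊ with hU
  have hU1 : (U:ℝ) * δ^K ≤ 1 := by
    have : (U:ℝ) ≤ (δ^K)⁻¹ := Nat.floor_le (by positivity)
    calc (U:ℝ) * δ^K ≤ (δ^K)⁻¹ * δ^K := by gcongr
      _ = 1 := inv_mul_cancel₀ (by positivity)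
  have hU2 : 1 ≤ (U + 1 : ℝ) * δ^K := by
    have : (δ^K)⁻¹ ≤ (U:ℝ) + 1 := (Nat.lt_floor_add_one _).le
    calc (1:ℝ) = (δ^K)⁻¹ * δ^K := (inv_mul_cancel₀ (by positivity)).symm
      _ ≤ _ := by gcongr
  have hUN : (U:ℝ) ≤ N * δ := by
    have h6 : K * K + K * K = K + (K * K + (K * K - K - 1) + 1) := by
      have : 2 * K ≤ K * K := Nat.mul_le_mul_right _ hK2
      omega
    calc (U:ℝ) = U * 1 := (mul_one _).symm
      _ ≤ U * (N * (δ^(K*K))^2) := by gcongr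
      _ = N * (U * δ^K) * δ^(K*K + (K * K - K - 1) + 1) := by
          rw [sq, ← pow_add, h6, pow_add]; ring
      _ ≤ N * 1 * δ^1 := by
          have : δ^(K*K + (K * K - K - 1) + 1) ≤ δ^1 := pow_le_pow_of_le_one hδ.le hδ1 (by omega)
          gcongr
      _ = _ := by ring
  have hU4 : (U * U) * (U * U) ≤ N := by
    have h6 : K * K + K * K = K * 4 + (2 * (K * (K - 2))) := by
      obtain ⟨d, rfl⟩ := Nat.exists_eq_add_of_le hK2
      rw [Nat.add_sub_cancel_left]; ring
    have : ((U * U) * (U * U) : ℝ) ≤ N := by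
      calc ((U * U) * (U * U) : ℝ) = U^4 * 1 := by ring
        _ ≤ U^4 * (N * (δ^(K*K))^2) := by gcongr
        _ = N * (U * δ^K)^4 * δ^(2 * (K * (K-2))) := by
            rw [sq, ← pow_add, h6, pow_add, pow_mul]; ring
        _ ≤ N * 1 * 1 := by
            have i1 : (U * δ^K)^4 ≤ 1 := pow_le_one₀ (by positivity) hU1
            have i2 : δ^(2 * (K * (K-2))) ≤ 1 := pow_le_one₀ hδ.le hδ1
            gcongr
        _ = N := by ring
    exact_mod_cast this
  have hUU : ∀ n, n ≤ U * U → n * n ≤ N := fun n hn => (Nat.mul_le_mul hn hn).trans hU4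
  have hlog := ctx.hTl
  have hlog0 : 0 ≤ Real.log N := Real.log_natCast_nonneg N
  set F : ℕ → ℂ := fun n => e (α * (n:ℝ)^(j+2)) with hF
  set S : ArithmeticFunction ℝ → ℂ := fun f => ∑ n ∈ Icc 1 N, ((f n : ℝ):ℂ) * F n with hS
  have Sadd : ∀ f g, S (f + g) = S f + S g := by
    intro f g
    simp only [hS, ArithmeticFunction.add_apply]
    rw [← sum_add_distrib]
    exact sum_congr rfl fun n _ => by push_cast; ring
  have Ssub : ∀ f g, S (f - g) = S f - S g := by
    intro f g
    have := Sadd (f - g) g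
    rw [sub_add_cancel] at this
    rw [this]; ring
  change ‖S ArithmeticFunction.vonMangoldt‖ ≤ _
  rw [vaughan U, Sadd, Ssub, Sadd]
  set La : ArithmeticFunction ℝ := ArithmeticFunction.vonMangoldt with hLa
  -- S0
  have b0 : ‖S (res (fun n => n ≤ U) La)‖ ≤ T * (N * δ) := by
    calc _ ≤ ∑ n ∈ Icc 1 N, if n ≤ U then T else 0 := by
          refine (norm_sum_le _ _).trans (sum_le_sum fun n hn => ?_)
          rw [mem_Icc] at hn
          rw [norm_mul, hF, norm_e, mul_one, Complex.norm_real, Real.norm_eq_abs, res_apply]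
          split_ifs
          · exact (vm_le hn.1 hn.2).trans hlog
          · simp
      _ = ∑ n ∈ (Icc 1 N).filter (fun n => n ≤ U), T := by rw [sum_filter]
      _ ≤ U * T := by
          rw [sum_const, nsmul_eq_mul]
          have : #((Icc 1 N).filter (fun n => n ≤ U)) ≤ U := by
            calc _ ≤ #(Icc 1 U) := card_le_card (by
                  intro n hn
                  rw [mem_filter, mem_Icc] at hn
                  rw [mem_Icc]; exact ⟨hn.1.1, hn.2⟩)
              _ = U := by simp
          gcongr
      _ ≤ (N * δ) * T := by gcongr
      _ = _ := by ring
  -- S1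
  have b1 : ‖S (res (fun n => n ≤ U) mu * ArithmeticFunction.log)‖ ≤ C1 * T^(j+3) * (2 * Real.log N * 1 * N * δ) := by
    refine hH1 U hU1 _ _ _ 1 (by positivity) zero_le_one (good_log' N) ?_ ?_
    · intro n _ _; exact (abs_res_le _ _ _).trans (abs_mu_le _)
    · intro n hn
      by_contra h
      exact hn (by rw [res_apply, if_neg h])
  -- S2
  set c := res (fun n => n ≤ U) La * res (fun n => n ≤ U) mu with hcdef
  have b2a : ‖S (res (fun n => n ≤ U) c * ze)‖ ≤ C1 * T^(j+3) * (1 * T * N * δ) := by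
    refine hH1 U hU1 _ _ _ T zero_le_one (by linarith) (good_ze N) ?_ ?_
    · intro n h1 h2
      exact (abs_res_le _ _ _).trans ((cc_le U h1 h2).trans hlog)
    · intro n hn
      by_contra h
      exact hn (by rw [res_apply, if_neg h])
  have b2b : ‖S (res (fun n => ¬ n ≤ U) c * ze)‖ ≤ C2 * T^(2*j+4) * (1 * T * N * δ) := by
    refine hH2 U hU2 _ _ _ T zero_le_one (by linarith) ?_ ?_ ?_
    · intro n _ _
      rw [ze, ArithmeticFunction.natCoe_apply, ArithmeticFunction.zeta_apply]
      split_ifs <;> simp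
    · intro n h1 h2
      exact (abs_res_le _ _ _).trans ((cc_le U h1 h2).trans hlog)
    · intro n hn
      obtain ⟨h, hn⟩ := res_ne hn
      exact ⟨not_le.1 h, hUU n (cc_supp U hn)⟩
  have b2 : S (c * ze) = S (res (fun n => n ≤ U) c * ze) + S (res (fun n => ¬ n ≤ U) c * ze) := by
    rw [← Sadd, ← add_mul, res_add]
  -- S3
  set f := res (fun n => ¬ n ≤ U) La with hf
  set g := res (fun n => ¬ n ≤ U) mu * ze with hg
  have hfT : ∀ n, 1 ≤ n → n ≤ N → |f n| ≤ T := fun n h1 h2 =>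
    (abs_res_le _ _ _).trans ((vm_le h1 h2).trans hlog)
  have hgT : ∀ n, 1 ≤ n → n ≤ N → |g n| ≤ T := fun n h1 h2 =>
    (dn_le U n).trans (ctx.hd n h1 (h2.trans hYN))
  have b3a : ‖S (res (fun n => n * n ≤ N) f * g)‖ ≤ C2 * T^(2*j+4) * (T * T * N * δ) := by
    refine hH2 U hU2 _ _ T T (by linarith) (by linarith) hgT ?_ ?_
    · intro n h1 h2
      exact (abs_res_le _ _ _).trans (hfT n h1 h2)
    · intro n hn
      rw [res_apply] at hn
      split_ifs at hn with h
      · refine ⟨?_, h⟩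
        by_contra h'
        exact hn (by rw [hf, res_apply, if_neg (by rw [not_not]; omega)])
      · exact absurd rfl hn
  have b3b : ‖S (res (fun n => n * n ≤ N) g * res (fun n => ¬ n * n ≤ N) f)‖ ≤ C2 * T^(2*j+4) * (T * T * N * δ) := by
    refine hH2 U hU2 _ _ T T (by linarith) (by linarith) ?_ ?_ ?_
    · intro n h1 h2
      exact (abs_res_le _ _ _).trans (hfT n h1 h2)
    · intro n h1 h2
      exact (abs_res_le _ _ _).trans (hgT n h1 h2)
    · intro n hn
      rw [res_apply] at hn
      split_ifs at hn with h
      · exact ⟨dn_supp U n hn, h⟩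
      · exact absurd rfl hn
  have b3c : S (res (fun n => ¬ n * n ≤ N) g * res (fun n => ¬ n * n ≤ N) f) = 0 := by
    refine sum_eq_zero fun n hn => ?_
    rw [mem_Icc] at hn
    have : (res (fun n => ¬ n * n ≤ N) g * res (fun n => ¬ n * n ≤ N) f) n = 0 := by
      rw [ArithmeticFunction.mul_apply]
      refine sum_eq_zero fun x hx => ?_
      rw [Nat.mem_divisorsAntidiagonal] at hx
      rw [res_apply, res_apply]
      by_cases h1 : x.1 * x.1 ≤ N
      · simp [h1]
      by_cases h2 : x.2 * x.2 ≤ N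
      · simp [h2]
      · exfalso
        have h3 := Nat.mul_lt_mul'' (not_le.1 h1) (not_le.1 h2)
        have h4 : x.1 * x.1 * (x.2 * x.2) = n * n := by rw [← hx.1]; ring
        rw [h4] at h3
        have := Nat.mul_le_mul hn.2 hn.2
        omega
    rw [this]; simp
  have b3 : S (f * g) = S (res (fun n => n * n ≤ N) f * g) + S (res (fun n => n * n ≤ N) g * res (fun n => ¬ n * n ≤ N) f) := by
    have e1 : f * g = res (fun n => n * n ≤ N) f * g + (res (fun n => n * n ≤ N) g * res (fun n => ¬ n * n ≤ N) f + res (fun n => ¬ n * n ≤ N) g * res (fun n => ¬ n * n ≤ N) f) := by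
      rw [← add_mul, res_add, mul_comm g, ← add_mul, res_add]
    rw [e1, Sadd, Sadd, b3c, add_zero]
  have hNδ : 0 ≤ N * δ := by positivity
  have p1 : T ≤ T^(2*j+6) := le_self_pow₀ hT (by omega)
  have p2 : T^(j+3) * Real.log N ≤ T^(2*j+6) := by
    calc T^(j+3) * Real.log N ≤ T^(j+3) * T := by gcongr
      _ = T^(j+4) := by ring
      _ ≤ _ := pow_le_pow_right₀ hT (by omega)
  have p3 : T^(j+3) * T ≤ T^(2*j+6) := by
    rw [← pow_succ]; exact pow_le_pow_right₀ hT (by omega)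
  have p4 : T^(2*j+4) * T ≤ T^(2*j+6) := by
    rw [← pow_succ]; exact pow_le_pow_right₀ hT (by omega)
  have q0 : ‖S (res (fun n => n ≤ U) La)‖ ≤ T^(2*j+6) * (N * δ) :=
    b0.trans (by gcongr)
  have q1 : ‖S (res (fun n => n ≤ U) mu * ArithmeticFunction.log)‖ ≤ 2 * C1 * (T^(2*j+6) * (N * δ)) := by
    refine b1.trans ?_
    calc _ = 2 * C1 * ((T^(j+3) * Real.log N) * (N * δ)) := by ring
      _ ≤ _ := by gcongr
  have q2a : ‖S (res (fun n => n ≤ U) c * ze)‖ ≤ C1 * (T^(2*j+6) * (N * δ)) := by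
    refine b2a.trans ?_
    calc _ = C1 * ((T^(j+3) * T) * (N * δ)) := by ring
      _ ≤ _ := by gcongr
  have q2b : ‖S (res (fun n => ¬ n ≤ U) c * ze)‖ ≤ C2 * (T^(2*j+6) * (N * δ)) := by
    refine b2b.trans ?_
    calc _ = C2 * ((T^(2*j+4) * T) * (N * δ)) := by ring
      _ ≤ _ := by gcongr
  have q3a : ‖S (res (fun n => n * n ≤ N) f * g)‖ ≤ C2 * (T^(2*j+6) * (N * δ)) := by
    refine b3a.trans (le_of_eq ?_); ring
  have q3b : ‖S (res (fun n => n * n ≤ N) g * res (fun n => ¬ n * n ≤ N) f)‖ ≤ C2 * (T^(2*j+6) * (N * δ)) := by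
    refine b3b.trans (le_of_eq ?_); ring
  rw [b2, b3, mul_assoc]
  generalize T^(2*j+6) * (N * δ) = Q at *
  generalize S (res (fun n => n ≤ U) La) = z0 at *
  generalize S (res (fun n => n ≤ U) mu * ArithmeticFunction.log) = z1 at *
  generalize S (res (fun n => n ≤ U) c * ze) = z2 at *
  generalize S (res (fun n => ¬ n ≤ U) c * ze) = z3 at *
  generalize S (res (fun n => n * n ≤ N) f * g) = z4 at *
  generalize S (res (fun n => n * n ≤ N) g * res (fun n => ¬ n * n ≤ N) f) = z5 at *
  have m1 := norm_add_le (z0 + z1 - (z2 + z3)) (z4 + z5)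
  have m2 := norm_sub_le (z0 + z1) (z2 + z3)
  have m3 := norm_add_le z0 z1
  have m4 := norm_add_le z2 z3
  have m5 := norm_add_le z4 z5
  linarith

end HarmanAux

namespace HarmanAux

lemma primes_diff (N : ℕ) (hN : 1 ≤ N) (F : ℕ → ℂ) (hF : ∀ n, ‖F n‖ = 1) :
    ‖∑ p ∈ (Icc 1 N).filter Nat.Prime, (Real.log p : ℂ) * F p‖ ≤
      ‖∑ n ∈ Icc 1 N, ((ArithmeticFunction.vonMangoldt n : ℝ):ℂ) * F n‖ + 2 * √(N:ℝ) * Real.log N := by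
  have h1 : ∑ n ∈ Icc 1 N, ((ArithmeticFunction.vonMangoldt n : ℝ):ℂ) * F n =
      ∑ p ∈ (Icc 1 N).filter Nat.Prime, (Real.log p : ℂ) * F p +
      ∑ n ∈ (Icc 1 N).filter (fun n => ¬ Nat.Prime n), ((ArithmeticFunction.vonMangoldt n : ℝ):ℂ) * F n := by
    rw [← sum_filter_add_sum_filter_not (Icc 1 N) Nat.Prime]
    congr 1
    refine sum_congr rfl fun p hp => ?_
    rw [mem_filter] at hp
    rw [ArithmeticFunction.vonMangoldt_apply_prime hp.2]
  have h2 : ‖∑ n ∈ (Icc 1 N).filter (fun n => ¬ Nat.Prime n), ((ArithmeticFunction.vonMangoldt n : ℝ):ℂ) * F n‖ ≤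
      2 * √(N:ℝ) * Real.log N := by
    have h3 := Chebyshev.psi_sub_theta_le (x := N) (by exact_mod_cast hN)
    rw [Chebyshev.psi_sub_theta_eq_sum_not_prime, Nat.floor_natCast] at h3
    refine le_trans ?_ h3
    refine (norm_sum_le _ _).trans (le_of_eq ?_)
    refine sum_congr rfl fun n _ => ?_
    rw [norm_mul, hF, mul_one, Complex.norm_real, Real.norm_of_nonneg ArithmeticFunction.vonMangoldt_nonneg]
  rw [h1]
  set A := ∑ p ∈ (Icc 1 N).filter Nat.Prime, (Real.log p : ℂ) * F p
  set B := ∑ n ∈ (Icc 1 N).filter (fun n => ¬ Nat.Prime n), ((ArithmeticFunction.vonMangoldt n : ℝ):ℂ) * F n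
  have : A = (A + B) - B := by ring
  calc ‖A‖ = ‖(A + B) - B‖ := by rw [← this]
    _ ≤ ‖A + B‖ + ‖B‖ := norm_sub_le _ _
    _ ≤ _ := by gcongr

lemma primes_trivial (N : ℕ) (F : ℕ → ℂ) (hF : ∀ n, ‖F n‖ = 1) :
    ‖∑ p ∈ (Icc 1 N).filter Nat.Prime, (Real.log p : ℂ) * F p‖ ≤ 2 * N := by
  have h1 := Chebyshev.theta_le_log4_mul_x (x := N) (by positivity)
  have h4 : Real.log 4 ≤ 2 := by
    have : Real.log 4 = 2 * Real.log 2 := by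
      rw [show (4:ℝ) = 2^2 by norm_num, Real.log_pow]; norm_num
    rw [this]
    have := Real.log_two_lt_d9
    linarith
  have h2 : ‖∑ p ∈ (Icc 1 N).filter Nat.Prime, (Real.log p : ℂ) * F p‖ ≤ Chebyshev.theta N := by
    rw [Chebyshev.theta, Nat.floor_natCast]
    refine (norm_sum_le _ _).trans (le_of_eq ?_)
    refine sum_congr rfl fun n _ => ?_
    rw [norm_mul, hF, mul_one, Complex.norm_real, Real.norm_of_nonneg (Real.log_natCast_nonneg _)]
  calc _ ≤ _ := h2
    _ ≤ _ := h1
    _ ≤ _ := by gcongr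

lemma exists_T (k R : ℕ) (η : ℝ) (hη : 0 < η) (hk : 1 ≤ k) : ∃ c : ℝ, 1 ≤ c ∧ ∀ N : ℕ, 1 ≤ N →
    (1 ≤ c * (N:ℝ)^η) ∧ (∀ l, 1 ≤ l → l ≤ R * N^k → (#(Nat.divisors l) : ℝ) ≤ c * (N:ℝ)^η) ∧
    (∀ q : ℕ, 1 ≤ q → q ≤ N^k → 1 + Real.log (2 * q) ≤ c * (N:ℝ)^η) ∧
    (Nat.log 2 N : ℝ) + 1 ≤ c * (N:ℝ)^η ∧ Real.log N ≤ c * (N:ℝ)^η := by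
  have hk' : (0:ℝ) < k := by exact_mod_cast hk
  obtain ⟨Cd, hCd, Hd⟩ := divisor_bound (η / k) (by positivity)
  have hR0 : 0 ≤ (R:ℝ)^(η/k) := by positivity
  refine ⟨Cd * (R:ℝ)^(η/k) + 2 + k / η + 2 / η, ?_, ?_⟩
  · have h1 : 0 ≤ Cd * (R:ℝ)^(η/k) := by positivity
    have h2 : 0 ≤ k / η := by positivity
    have h3 : 0 ≤ 2 / η := by positivity
    linarith
  intro N hN
  have hN' : (1:ℝ) ≤ N := by exact_mod_cast hN
  set X := (N:ℝ)^η with hX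
  have hX1 : 1 ≤ X := Real.one_le_rpow hN' hη.le
  have hlog : Real.log N ≤ X / η := Real.log_le_rpow_div (by positivity) hη
  have h1 : 0 ≤ Cd * (R:ℝ)^(η/k) * X := by positivity
  have h2 : 0 ≤ k / η * X := by positivity
  have h3 : 0 ≤ 2 / η * X := by positivity
  have h4 : 0 ≤ 1 / η * X := by positivity
  have h5 : X / η = 1 / η * X := by ring
  have h6 : 2 / η * X = 2 * (1 / η * X) := by ring
  have hlog0 : 0 ≤ Real.log N := Real.log_natCast_nonneg N
  refine ⟨by linarith, ?_, ?_, ?_, by linarith⟩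
  · intro l hl hlR
    have h7 := Hd l hl
    have h8 : (l:ℝ)^(η/k) ≤ (R:ℝ)^(η/k) * X := by
      have h9 : ((N:ℝ)^k)^(η/k) = X := by
        rw [← Real.rpow_natCast, ← Real.rpow_mul (by positivity), hX]
        congr 1; field_simp
      rw [← h9, ← Real.mul_rpow (by positivity) (by positivity)]
      have : (l:ℝ) ≤ R * (N:ℝ)^k := by exact_mod_cast hlR
      gcongr
    calc _ ≤ Cd * (l:ℝ)^(η/k) := h7
      _ ≤ Cd * ((R:ℝ)^(η/k) * X) := by gcongr
      _ ≤ _ := by linarith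
  · intro q hq hqN
    have hq' : (0:ℝ) < q := by exact_mod_cast hq
    rw [Real.log_mul (by norm_num) hq'.ne']
    have h7 : Real.log q ≤ k * Real.log N := by
      rw [← Real.log_pow]
      apply Real.log_le_log hq'
      exact_mod_cast hqN
    have h8 := Real.log_two_lt_d9
    have h9 : k * Real.log N ≤ k * (X / η) := by gcongr
    have h10 : k * (X / η) = k / η * X := by ring
    linarith
  · have h7 : (Nat.log 2 N : ℝ) * Real.log 2 ≤ Real.log N := by
      rw [← Real.log_pow]
      apply Real.log_le_log (by positivity)
      exact_mod_cast Nat.pow_log_le_self 2 (by omega)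
    have h8 := Real.log_two_gt_d9
    have h9 : (0:ℝ) ≤ Nat.log 2 N := by positivity
    have h10 : (Nat.log 2 N : ℝ) ≤ 2 * Real.log N := by nlinarith
    linarith

end HarmanAux

/-- Harman's exponential sum estimate over primes. -/
theorem harman_exponential_sum (k : ℕ) (hk : 2 ≤ k) (ε : ℝ) (hε : 0 < ε) :
    ∃ C > (0:ℝ), ∀ (α : ℝ) (a : ℤ) (q : ℕ), 0 < q → Int.gcd a (q : ℤ) = 1 →
      |α - (a : ℝ) / (q : ℝ)| < 1/(q:ℝ)^2 → ∀ N : ℕ, 2 ≤ N →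
      ‖∑ p ∈ (Finset.Icc 1 N).filter Nat.Prime, (Real.log p : ℂ) * e ((p:ℝ)^k * α)‖
        ≤ C * (N:ℝ) ^ (1 + ε) *
          (1/(q:ℝ) + 1/(N:ℝ) ^ ((1:ℝ)/2) + (q:ℝ)/(N:ℝ)^k) ^ ((4:ℝ) ^ (1 - (k:ℝ))) := by
  obtain ⟨j, rfl⟩ := Nat.exists_eq_add_of_le' hk
  obtain ⟨C1, R, hC1, H⟩ := HarmanAux.mangoldt_bound j
  have hη : 0 < ε / (2*j+6 : ℕ) := by positivity
  set η := ε / (2*j+6 : ℕ) with hηd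
  obtain ⟨c, hc1, Hc⟩ := HarmanAux.exists_T (j+2) R η hη (by omega)
  refine ⟨(C1 + 2) * c^(2*j+6) + 2, by positivity, ?_⟩
  intro α a q hq hcop hα N hN
  have hN1 : 1 ≤ N := by omega
  have hN' : (1:ℝ) ≤ N := by exact_mod_cast hN1
  have hN0 : (0:ℝ) < N := by linarith
  have hq' : (0:ℝ) < q := by exact_mod_cast hq
  set γ : ℝ := (4:ℝ) ^ (1 - ((j+2 : ℕ):ℝ)) with hγ
  have hγ0 : 0 < γ := by positivity
  set Δ : ℝ := 1/(q:ℝ) + 1/(N:ℝ) ^ ((1:ℝ)/2) + (q:ℝ)/(N:ℝ)^(j+2) with hΔ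
  have hΔ0 : 0 < Δ := by positivity
  have hNε : (N:ℝ)^(1+ε) = N * (N:ℝ)^ε := by rw [Real.rpow_add hN0, Real.rpow_one]
  have hNε1 : 1 ≤ (N:ℝ)^ε := Real.one_le_rpow hN' hε.le
  set F : ℕ → ℂ := fun n => e (α * (n:ℝ)^(j+2)) with hF
  have hF1 : ∀ n, ‖F n‖ = 1 := fun n => HarmanAux.norm_e _
  have hsum : ∑ p ∈ (Finset.Icc 1 N).filter Nat.Prime, (Real.log p : ℂ) * e ((p:ℝ)^(j+2) * α) =
      ∑ p ∈ (Finset.Icc 1 N).filter Nat.Prime, (Real.log p : ℂ) * F p := by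
    refine sum_congr rfl fun p _ => ?_
    rw [mul_comm ((p:ℝ)^(j+2)) α]
  rw [hsum]
  rcases le_or_gt 1 Δ with h1 | h1
  · have h2 : 1 ≤ Δ^γ := Real.one_le_rpow h1 hγ0.le
    calc _ ≤ 2 * (N:ℝ) := HarmanAux.primes_trivial N F hF1
      _ = 2 * (N * 1) * 1 := by ring
      _ ≤ ((C1 + 2) * c^(2*j+6) + 2) * (N * (N:ℝ)^ε) * Δ^γ := by
          have : 0 ≤ (C1 + 2) * c^(2*j+6) := by positivity
          gcongr
          linarith
      _ = _ := by rw [hNε]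
  obtain ⟨hT1, hTd, hTq, hTN, hTl⟩ := Hc N hN1
  set T := c * (N:ℝ)^η with hT
  set δ := Δ^γ with hδ
  have hδ0 : 0 < δ := by positivity
  have hδ1 : δ ≤ 1 := Real.rpow_le_one hΔ0.le h1.le hγ0.le
  have hδD : δ^(2^(j+1) * 2^(j+1)) = Δ := by
    rw [hδ, ← Real.rpow_natCast, ← Real.rpow_mul hΔ0.le]
    have : γ * ((2^(j+1) * 2^(j+1) : ℕ):ℝ) = 1 := by
      have e1 : γ = ((4:ℝ)^(j+1))⁻¹ := by
        rw [hγ, ← Real.rpow_natCast, ← Real.rpow_neg (by norm_num)]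
        congr 1; push_cast; ring
      rw [e1]
      push_cast
      rw [← mul_pow]
      norm_num
    rw [this, Real.rpow_one]
  have t1 : 0 < 1/(q:ℝ) := by positivity
  have t2 : 0 < 1/(N:ℝ) ^ ((1:ℝ)/2) := by positivity
  have t3 : 0 < (q:ℝ)/(N:ℝ)^(j+2) := by positivity
  have hsq : (N:ℝ)^((1:ℝ)/2) = √(N:ℝ) := (Real.sqrt_eq_rpow _).symm
  have hsq0 : 0 < √(N:ℝ) := Real.sqrt_pos.2 hN0
  have hsΔ : 1 / √(N:ℝ) ≤ Δ := by rw [← hsq]; linarith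
  have hqΔ : (q:ℝ) ≤ (N:ℝ)^(j+2) * Δ := by
    have : (q:ℝ)/(N:ℝ)^(j+2) ≤ Δ := by linarith
    rwa [div_le_iff₀ (by positivity), mul_comm] at this
  have hqN : q ≤ N^(j+2) := by
    have : (q:ℝ) ≤ (N:ℝ)^(j+2) := by
      calc (q:ℝ) ≤ (N:ℝ)^(j+2) * Δ := hqΔ
        _ ≤ (N:ℝ)^(j+2) * 1 := by gcongr
        _ = _ := mul_one _
    exact_mod_cast this
  have ctx : HarmanAux.Ctx j α a q N δ T (R * N^(j+2)) := by
    refine ⟨hq, hcop, hα, hN1, hδ0, hδ1, ?_, ?_, ?_, hT1, hTd, hTq q hq hqN, hTN, hTl⟩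
    · rw [hδD]; linarith
    · rw [hδD]
      calc (1:ℝ) = N * (1 / √(N:ℝ))^2 := by
            rw [div_pow, Real.sq_sqrt hN0.le]; field_simp
        _ ≤ _ := by gcongr
    · rw [hδD]; exact hqΔ
  have main := H α a q N δ T _ ctx le_rfl
  have hΔδ : Δ ≤ δ := by
    rw [← hδD]; exact pow_le_of_le_one hδ0.le hδ1 (by positivity)
  have hsqN : √(N:ℝ) ≤ N * δ := by
    calc √(N:ℝ) = N * (1 / √(N:ℝ)) := by
          rw [mul_one_div, Real.div_sqrt]
      _ ≤ N * δ := by gcongr; exact hsΔ.trans hΔδ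
  have hTp : T^(2*j+6) = c^(2*j+6) * (N:ℝ)^ε := by
    rw [hT, mul_pow, ← Real.rpow_natCast ((N:ℝ)^η), ← Real.rpow_mul hN0.le, hηd,
      div_mul_cancel₀ _ (by positivity)]
  have hTT : T ≤ T^(2*j+6) := le_self_pow₀ hT1 (by omega)
  have hl0 : 0 ≤ Real.log N := Real.log_natCast_nonneg N
  have hT0 : 0 ≤ T := by linarith
  calc _ ≤ ‖∑ n ∈ Icc 1 N, ((ArithmeticFunction.vonMangoldt n : ℝ):ℂ) * F n‖ + 2 * √(N:ℝ) * Real.log N :=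
        HarmanAux.primes_diff N hN1 F hF1
    _ ≤ C1 * T^(2*j+6) * (N * δ) + 2 * (N * δ) * T^(2*j+6) := by
        have := hTl.trans hTT
        gcongr
    _ = (C1 + 2) * T^(2*j+6) * (N * δ) := by ring
    _ = ((C1 + 2) * c^(2*j+6) + 0) * (N * (N:ℝ)^ε) * δ := by rw [hTp]; ring
    _ ≤ ((C1 + 2) * c^(2*j+6) + 2) * (N * (N:ℝ)^ε) * δ := by gcongr; norm_num
    _ = _ := by rw [hNε]
end

section
/- Let λ be a fixed nonzero real number. There is a constant C such that for all sufficiently large X, ∫_{|α| ≤ X^{−2/3}} |S₂(λα, ρ)|² dα ≤ C. -/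
open MeasureTheory Finset
open scoped Classical

lemma aux_gauss (b : ℝ) (hb : 0 < b) (s : Finset ℕ) (a ω : ℕ → ℝ) (K : ℝ) (hK : ∀ m ∈ s, |a m| ≤ K) :
    Integrable (fun α : ℝ => Real.exp (-b * α ^ 2) * ‖∑ m ∈ s, (a m : ℂ) * e (ω m * α)‖ ^ 2) ∧
    ∫ α : ℝ, Real.exp (-b * α ^ 2) * ‖∑ m ∈ s, (a m : ℂ) * e (ω m * α)‖ ^ 2
      ≤ K ^ 2 * √(Real.pi / b) *
        ∑ m ∈ s, ∑ n ∈ s, Real.exp (-(2 * Real.pi * (ω m - ω n)) ^ 2 / (4 * b)) := by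
  have hbC : 0 < (b : ℂ).re := by simpa using hb
  have key : ∀ α : ℝ, ((Real.exp (-b * α ^ 2) * ‖∑ m ∈ s, (a m : ℂ) * e (ω m * α)‖ ^ 2 : ℝ) : ℂ)
      = ∑ m ∈ s, ∑ n ∈ s, ((a m : ℂ) * a n) *
        (Complex.exp (Complex.I * ((2 * Real.pi * (ω m - ω n) : ℝ) : ℂ) * α) *
          Complex.exp (-(b:ℂ) * (α:ℂ) ^ 2)) := by
    intro α
    rw [Complex.ofReal_mul, Complex.ofReal_pow, ← Complex.mul_conj', map_sum, Finset.sum_mul_sum,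
      Finset.mul_sum]
    refine Finset.sum_congr rfl fun m _ => ?_
    rw [Finset.mul_sum]
    refine Finset.sum_congr rfl fun n _ => ?_
    have h1 : (starRingEnd ℂ) (e (ω n * α)) = Complex.exp (-(2 * Real.pi * Complex.I * (ω n * α))) := by
      unfold e
      rw [← Complex.exp_conj]
      congr 1
      simp
      left
      exact Complex.conj_ofNat 2
    rw [map_mul, h1, Complex.conj_ofReal, Complex.ofReal_exp]
    unfold e
    have h2 : Complex.exp (Complex.I * ((2 * Real.pi * (ω m - ω n) : ℝ) : ℂ) * α) =
      Complex.exp (2 * Real.pi * Complex.I * ((ω m * α : ℝ) : ℂ)) *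
        Complex.exp (-(2 * Real.pi * Complex.I * (ω n * α))) := by
      rw [← Complex.exp_add]
      congr 1
      push_cast
      ring
    rw [h2]
    push_cast
    ring
  have hint : ∀ t : ℝ, Integrable (fun α : ℝ => Complex.exp (Complex.I * (t : ℂ) * α) *
          Complex.exp (-(b:ℂ) * (α:ℂ) ^ 2)) := by
    intro t
    have := GaussianFourier.integrable_cexp_neg_mul_sq_add_real_mul_I hbC 0
    have h3 := integrable_cexp_quadratic hbC (Complex.I * t) 0
    refine h3.congr (Filter.Eventually.of_forall fun x => ?_)
    simp only
    rw [← Complex.exp_add]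
    congr 1
    ring
  have hI : Integrable (fun α : ℝ => ((Real.exp (-b * α ^ 2) * ‖∑ m ∈ s, (a m : ℂ) * e (ω m * α)‖ ^ 2 : ℝ) : ℂ)) := by
    simp_rw [key]
    exact integrable_finsetSum _ fun m _ => integrable_finsetSum _ fun n _ => (hint _).const_mul _
  have hIr : Integrable (fun α : ℝ => Real.exp (-b * α ^ 2) * ‖∑ m ∈ s, (a m : ℂ) * e (ω m * α)‖ ^ 2) := by
    have := hI.re
    simpa only [RCLike.re_eq_complex_re, Complex.ofReal_re] using this
  refine ⟨hIr, ?_⟩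
  have h0 : ((∫ α : ℝ, Real.exp (-b * α ^ 2) * ‖∑ m ∈ s, (a m : ℂ) * e (ω m * α)‖ ^ 2 : ℝ) : ℂ)
      = ∑ m ∈ s, ∑ n ∈ s, ((a m : ℂ) * a n) * ((Real.pi / b : ℂ) ^ (1 / 2 : ℂ) *
        Complex.exp (-((2 * Real.pi * (ω m - ω n) : ℝ) : ℂ) ^ 2 / (4 * b))) := by
    rw [← integral_complex_ofReal]
    simp_rw [key]
    rw [integral_finsetSum _ fun m _ => integrable_finsetSum _ fun n _ => (hint _).const_mul _]
    refine Finset.sum_congr rfl fun m _ => ?_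
    rw [integral_finsetSum _ fun n _ => (hint _).const_mul _]
    refine Finset.sum_congr rfl fun n _ => ?_
    rw [integral_const_mul, fourierIntegral_gaussian hbC]
  refine (le_abs_self _).trans ?_
  rw [← Real.norm_eq_abs, ← Complex.norm_real, h0, Finset.mul_sum]
  refine (norm_sum_le _ _).trans (Finset.sum_le_sum fun m hm => ?_)
  rw [Finset.mul_sum]
  refine (norm_sum_le _ _).trans (Finset.sum_le_sum fun n hn => ?_)
  have hs : ‖(Real.pi / b : ℂ) ^ (1 / 2 : ℂ)‖ = √(Real.pi / b) := by
    rw [Real.sqrt_eq_rpow, show (Real.pi / b : ℂ) = ((Real.pi / b : ℝ) : ℂ) by push_cast; rfl,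
      Complex.norm_cpow_eq_rpow_re_of_pos (by positivity)]
    simp
  have he : ‖Complex.exp (-((2 * Real.pi * (ω m - ω n) : ℝ) : ℂ) ^ 2 / (4 * b))‖
      = Real.exp (-(2 * Real.pi * (ω m - ω n)) ^ 2 / (4 * b)) := by
    rw [show (-((2 * Real.pi * (ω m - ω n) : ℝ) : ℂ) ^ 2 / (4 * b)) =
      ((-(2 * Real.pi * (ω m - ω n)) ^ 2 / (4 * b) : ℝ) : ℂ) by push_cast; rfl]
    rw [← Complex.ofReal_exp, Complex.norm_real, Real.norm_eq_abs, abs_of_pos (Real.exp_pos _)]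
  rw [norm_mul, norm_mul, norm_mul, hs, he, Complex.norm_real, Complex.norm_real, ← mul_assoc]
  have : ‖a m‖ * ‖a n‖ ≤ K ^ 2 := by
    rw [sq]
    exact mul_le_mul (hK m hm) (hK n hn) (norm_nonneg _) ((abs_nonneg _).trans (hK m hm))
  gcongr

lemma aux_sum1 (A : ℝ) (hA : 0 < A) (N : ℕ) :
    ∑ k ∈ Finset.range N, 1 / (1 + ((k:ℝ) / A) ^ 2) ≤ 1 + 2 * A := by
  have h : ∑ k ∈ Finset.range (N + 1), 1 / (1 + ((k:ℝ) / A) ^ 2)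
      ≤ 1 + 2 * A - 2 * A ^ 2 / (A + N) := by
    induction N with
    | zero =>
      simp only [Nat.cast_zero, add_zero, zero_add, Finset.sum_range_one]
      have : 2 * A ^ 2 / A = 2 * A := by field_simp
      rw [this]; norm_num
    | succ N ih =>
      rw [Finset.sum_range_succ]
      have e1 : 1 / (1 + (((N + 1 : ℕ):ℝ) / A) ^ 2) ≤ 2 * A ^ 2 / ((A + N) * (A + (N + 1 : ℕ))) := by
        have hN : (0:ℝ) ≤ N := by positivity
        push_cast
        have e0 : 1 / (1 + (((N:ℝ) + 1) / A) ^ 2) = A ^ 2 / (A ^ 2 + ((N:ℝ) + 1) ^ 2) := by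
          field_simp
        rw [e0, div_le_div_iff₀ (by positivity) (by positivity)]
        have : (A + N) * (A + (N + 1)) ≤ 2 * (A ^ 2 + ((N:ℝ) + 1) ^ 2) := by
          nlinarith [sq_nonneg (A - (N + 1))]
        nlinarith [sq_nonneg A, mul_le_mul_of_nonneg_left this (sq_nonneg A)]
      have e2 : 2 * A ^ 2 / ((A + N) * (A + (N + 1 : ℕ))) =
          2 * A ^ 2 / (A + N) - 2 * A ^ 2 / (A + (N + 1 : ℕ)) := by
        push_cast
        field_simp
        ring
      linarith
  have h2 : 0 ≤ 2 * A ^ 2 / (A + N) := by positivity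
  rw [Finset.sum_range_succ] at h
  have h3 : 0 ≤ 1 / (1 + ((N:ℝ) / A) ^ 2) := by positivity
  linarith

lemma aux_sum2 (A : ℝ) (hA : 0 < A) (N m : ℕ) :
    ∑ n ∈ Finset.range N, 1 / (1 + (((m:ℝ) - n) / A) ^ 2) ≤ 2 * (1 + 2 * A) := by
  have h1 : ∑ n ∈ Finset.range N, 1 / (1 + (((m:ℝ) - n) / A) ^ 2) ≤
      ∑ n ∈ Finset.range (m + N), 1 / (1 + (((m:ℝ) - n) / A) ^ 2) := by
    apply Finset.sum_le_sum_of_subset_of_nonneg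
    · intro x; simp; omega
    · intros; positivity
  refine h1.trans ?_
  rw [Finset.sum_range_add]
  have h2 : ∑ x ∈ Finset.range N, 1 / (1 + (((m:ℝ) - ((m + x : ℕ) : ℝ)) / A) ^ 2) ≤ 1 + 2 * A := by
    refine le_trans (le_of_eq ?_) (aux_sum1 A hA N)
    refine Finset.sum_congr rfl fun x _ => ?_
    push_cast
    congr 2
    ring
  have h3 : ∑ x ∈ Finset.range m, 1 / (1 + (((m:ℝ) - x) / A) ^ 2) ≤ 1 + 2 * A := by
    rw [← Finset.sum_range_reflect]
    refine le_trans ?_ (aux_sum1 A hA m)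
    refine Finset.sum_le_sum fun x hx => ?_
    have hx := Finset.mem_range.1 hx
    have : (m:ℝ) - ((m - 1 - x : ℕ) : ℝ) = x + 1 := by
      have : ((m - 1 - x : ℕ) : ℝ) + x + 1 = m := by norm_cast; omega
      linarith
    rw [this]
    gcongr
    linarith
  linarith

lemma psi_mem (m : ℕ) (z : ℝ) : 0 ≤ psi m z ∧ psi m z ≤ 1 := by
  unfold psi; split_ifs <;> norm_num

lemma rho_bound (X : ℝ) (hX : 1 < X) (m : ℕ) (hm : 1 ≤ m) (hmX : (m:ℝ) ≤ X ^ ((1:ℝ)/2)) :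
    |rho X m| ≤ 6 := by
  unfold rho
  set s := m.primeFactors.filter
        (fun p : ℕ => X ^ ((5:ℝ)/42) ≤ (p:ℝ) ∧ (p:ℝ) ≤ X ^ ((1:ℝ)/4)) with hs
  have hcard : (s.card : ℝ) ≤ 5 := by
    have h1 : ∏ p ∈ s, p ∣ m :=
      (Finset.prod_dvd_prod_of_subset _ _ _ (Finset.filter_subset _ _)).trans (Nat.prod_primeFactors_dvd m)
    have h2 : ((∏ p ∈ s, p : ℕ) : ℝ) ≤ m := by exact_mod_cast Nat.le_of_dvd hm h1
    have h3 : (X ^ ((5:ℝ)/42)) ^ s.card ≤ ((∏ p ∈ s, p : ℕ) : ℝ) := by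
      push_cast
      rw [← Finset.prod_const]
      exact Finset.prod_le_prod (fun _ _ => by positivity) fun p hp => (Finset.mem_filter.1 hp).2.1
    have h4 := (h3.trans h2).trans hmX
    rw [← Real.rpow_natCast, ← Real.rpow_mul (by linarith), Real.rpow_le_rpow_left_iff hX] at h4
    linarith
  have h1 : 0 ≤ ∑ p ∈ s, psi (m / p) (zP X p) := Finset.sum_nonneg fun _ _ => (psi_mem _ _).1
  have h2 : ∑ p ∈ s, psi (m / p) (zP X p) ≤ 5 :=
    (Finset.sum_le_card_nsmul s _ 1 fun _ _ => (psi_mem _ _).2).trans (by simpa using hcard)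
  have := psi_mem m (X ^ ((5:ℝ)/42))
  rw [abs_le]; constructor <;> linarith

/-- mean square of `S₂(λα, ρ)` near the origin is bounded. -/
theorem S2_mean_square_bounded (lam : ℝ) (hlam : lam ≠ 0)
    (η : ℝ) (hη : 0 < η) (hη1 : η < 1) :
    ∃ C > (0:ℝ), ∃ X₀ : ℝ, ∀ X ≥ X₀,
      (∫ α in Set.Icc (-(X ^ (-(2:ℝ)/3))) (X ^ (-(2:ℝ)/3)), ‖S2 η X (lam * α)‖ ^ 2)
        ≤ C := by
  refine ⟨Real.exp 1 * (36 * √Real.pi * (2 * (1 + 2 * (1 / (|lam| * √η))))), by positivity, 2, fun X hX => ?_⟩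
  have hX0 : 0 < X := by linarith
  have hl : 0 < |lam| := abs_pos.2 hlam
  have hse : 0 < √η := Real.sqrt_pos.2 hη
  set D := X ^ (-(2:ℝ)/3) with hD
  have hD0 : 0 < D := by positivity
  set Y := X ^ ((1:ℝ)/6) with hY
  have hY1 : 1 ≤ Y := Real.one_le_rpow (by linarith) (by norm_num)
  have hXY : X = Y ^ 6 := by
    rw [hY, ← Real.rpow_natCast, ← Real.rpow_mul hX0.le]; norm_num
  have hDY : D * Y ^ 4 = 1 := by
    rw [hD, hY, ← Real.rpow_natCast, ← Real.rpow_mul hX0.le, ← Real.rpow_add hX0]; norm_num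
  have hhalf : X ^ ((1:ℝ)/2) = Y ^ 3 := by
    rw [hY, ← Real.rpow_natCast, ← Real.rpow_mul hX0.le]; norm_num
  set s := (Finset.Icc 1 ⌊X ^ ((1:ℝ)/2)⌋₊).filter
      (fun m : ℕ => (η * X) ^ ((1:ℝ)/2) ≤ (m : ℝ)) with hs
  have hmem : ∀ m ∈ s, 1 ≤ m ∧ (m:ℝ) ≤ X ^ ((1:ℝ)/2) ∧ √η * Y ^ 3 ≤ m := by
    intro m hm
    rw [hs, Finset.mem_filter, Finset.mem_Icc] at hm
    refine ⟨hm.1.1, (Nat.le_floor_iff (by positivity)).1 hm.1.2, ?_⟩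
    have := hm.2
    rwa [Real.mul_rpow hη.le hX0.le, hhalf, ← Real.sqrt_eq_rpow] at this
  have hcard : (s.card : ℝ) ≤ Y ^ 3 := by
    have h1 : s.card ≤ ⌊X ^ ((1:ℝ)/2)⌋₊ := (Finset.card_filter_le _ _).trans (by simp)
    rw [← hhalf]
    exact (Nat.le_floor_iff (by positivity)).1 h1
  have hb : 0 < 1 / D ^ 2 := by positivity
  obtain ⟨hint, hle⟩ := aux_gauss (1 / D ^ 2) hb s (rho X) (fun m => lam * (m:ℝ) ^ 2) 6
    (fun m hm => rho_bound X (by linarith) m (hmem m hm).1 (hmem m hm).2.1)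
  have hS : ∀ α : ℝ, S2 η X (lam * α) = ∑ m ∈ s, (rho X m : ℂ) * e (lam * (m:ℝ) ^ 2 * α) := by
    intro α
    unfold S2
    refine Finset.sum_congr rfl fun m _ => ?_
    congr 2
    ring
  simp only [← hS] at hint hle
  have hcont : Continuous fun α : ℝ => ‖S2 η X (lam * α)‖ ^ 2 := by
    unfold S2 e
    fun_prop
  set A := Y * (1 / (|lam| * √η)) with hA
  have hA0 : 0 < A := by positivity
  calc ∫ α in Set.Icc (-D) D, ‖S2 η X (lam * α)‖ ^ 2
      ≤ ∫ α in Set.Icc (-D) D, Real.exp 1 * (Real.exp (-(1 / D ^ 2) * α ^ 2) * ‖S2 η X (lam * α)‖ ^ 2) := by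
        refine setIntegral_mono_on hcont.integrableOn_Icc (hint.const_mul _).integrableOn measurableSet_Icc ?_
        intro α hα
        rw [← mul_assoc, ← Real.exp_add]
        refine le_mul_of_one_le_left (by positivity) (Real.one_le_exp ?_)
        have : α ^ 2 ≤ D ^ 2 := sq_le_sq' hα.1 hα.2
        have : α ^ 2 / D ^ 2 ≤ 1 := (div_le_one (by positivity)).2 this
        have h2 : -(1 / D ^ 2) * α ^ 2 = - (α ^ 2 / D ^ 2) := by ring
        linarith
    _ ≤ ∫ α : ℝ, Real.exp 1 * (Real.exp (-(1 / D ^ 2) * α ^ 2) * ‖S2 η X (lam * α)‖ ^ 2) :=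
        setIntegral_le_integral (hint.const_mul _) (Filter.Eventually.of_forall fun α => by positivity)
    _ ≤ Real.exp 1 * (6 ^ 2 * √(Real.pi / (1 / D ^ 2)) *
        ∑ m ∈ s, ∑ n ∈ s, Real.exp (-(2 * Real.pi * (lam * (m:ℝ) ^ 2 - lam * (n:ℝ) ^ 2)) ^ 2 / (4 * (1 / D ^ 2)))) := by
        rw [integral_const_mul]
        gcongr
    _ ≤ Real.exp 1 * (6 ^ 2 * (√Real.pi * D) * (Y ^ 3 * (2 * (1 + 2 * A)))) := by
        have hsq : √(Real.pi / (1 / D ^ 2)) = √Real.pi * D := by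
          rw [div_div_eq_mul_div, div_one, Real.sqrt_mul Real.pi_pos.le, Real.sqrt_sq hD0.le]
        rw [hsq]
        gcongr
        have hrow : ∀ m ∈ s, ∑ n ∈ s, Real.exp (-(2 * Real.pi * (lam * (m:ℝ) ^ 2 - lam * (n:ℝ) ^ 2)) ^ 2 / (4 * (1 / D ^ 2)))
            ≤ 2 * (1 + 2 * A) := by
          intro m hm
          refine le_trans ?_ (aux_sum2 A hA0 (⌊X ^ ((1:ℝ)/2)⌋₊ + 1) m)
          refine le_trans (Finset.sum_le_sum (g := fun n : ℕ => 1 / (1 + (((m:ℝ) - n) / A) ^ 2)) ?_) ?_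
          · intro n hn
            have hE : (((m:ℝ) - n) / A) ^ 2 ≤ (2 * Real.pi * (lam * (m:ℝ) ^ 2 - lam * (n:ℝ) ^ 2)) ^ 2 / (4 * (1 / D ^ 2)) := by
              have e1 : (2 * Real.pi * (lam * (m:ℝ) ^ 2 - lam * (n:ℝ) ^ 2)) ^ 2 / (4 * (1 / D ^ 2))
                  = ((m:ℝ) - n) ^ 2 * (Real.pi * |lam| * D * (m + n)) ^ 2 := by
                field_simp
                rw [sq_abs]
                ring
              have e2 : (((m:ℝ) - n) / A) ^ 2 = ((m:ℝ) - n) ^ 2 * (1 / A) ^ 2 := by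
                rw [div_eq_mul_one_div, mul_pow]
              rw [e1, e2]
              gcongr
              have e3 : 1 / A = |lam| * D * (√η * Y ^ 3) := by
                rw [hA]
                field_simp
                linarith
              rw [e3]
              have e4 := (hmem m hm).2.2
              have e5 : (0:ℝ) ≤ n := by positivity
              have e6 : (1:ℝ) ≤ Real.pi := by linarith [Real.pi_gt_three]
              calc |lam| * D * (√η * Y ^ 3) = 1 * |lam| * D * (√η * Y ^ 3) := by ring
                _ ≤ Real.pi * |lam| * D * (m + n) := by gcongr; linarith
            rw [neg_div, Real.exp_neg, ← one_div]
            refine one_div_le_one_div_of_le (by positivity) ?_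
            have := Real.add_one_le_exp ((2 * Real.pi * (lam * (m:ℝ) ^ 2 - lam * (n:ℝ) ^ 2)) ^ 2 / (4 * (1 / D ^ 2)))
            linarith
          · apply Finset.sum_le_sum_of_subset_of_nonneg
            · intro x hx
              rw [hs, Finset.mem_filter, Finset.mem_Icc] at hx
              rw [Finset.mem_range]; omega
            · intros; positivity
        refine (Finset.sum_le_card_nsmul s _ _ hrow).trans ?_
        rw [nsmul_eq_mul]
        gcongr
    _ ≤ _ := by
        have hfin : D * Y ^ 3 * (1 + 2 * A) ≤ 1 + 2 * (1 / (|lam| * √η)) := by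
          have : D * Y ^ 3 ≤ 1 := by
            rw [← hDY]
            have : Y ^ 3 ≤ Y ^ 4 := pow_le_pow_right₀ hY1 (by norm_num)
            gcongr
          have h2 : D * Y ^ 3 * A = 1 / (|lam| * √η) := by
            rw [hA, ← mul_assoc, show D * Y ^ 3 * Y = D * Y ^ 4 by ring, hDY, one_mul]
          linarith
        calc _ = Real.exp 1 * (36 * √Real.pi * (2 * (D * Y ^ 3 * (1 + 2 * A)))) := by ring
          _ ≤ _ := by gcongr
end
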